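/- Fix integers k ≥ 2 and p ≥ 1. For each n ≥ 1, let w_1, …, w_p be chosen independently and uniformly at random from the ball {g ∈ F_k : |g| ≤ n}. Then with probability going to 1 exponentially fast as n → ∞, the subgroup H = ⟨w_1, …, w_p⟩ is Aut-malnormal in F_k. -/

import Mathlib

open MeasureTheory

noncomputable section

/-- Every set of a free group is measurable (discrete σ-algebra). -/
instance freeGroupMeasurableSpace {α : Type*} : MeasurableSpace (FreeGroup α) := ⊤

/-- The length `|g|` of the reduced word representing `g`. -/
def wlen {k : ℕ} (g : FreeGroup (Fin k)) : ℕ := (FreeGroup.toWord g).length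

/-- A family of "failure probabilities" decays exponentially: the corresponding events
hold with probability going to 1 exponentially fast as `n → ∞`. -/
def ExpDecay (f : ℕ → ENNReal) : Prop :=
  ∃ C : ℝ, 0 < C ∧ ∃ κ : ℝ, 1 < κ ∧ ∀ n : ℕ, f n ≤ ENNReal.ofReal (C / κ ^ n)

/-- `H` is Aut-malnormal: any automorphism `α` with `α(H) ∩ H ≠ {1}` is conjugation by an
element of `H`. -/
def AutMalnormal {k : ℕ} (H : Subgroup (FreeGroup (Fin k))) : Prop :=
  ∀ α : FreeGroup (Fin k) ≃* FreeGroup (Fin k),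
    (∃ x : FreeGroup (Fin k), x ≠ 1 ∧ x ∈ H ∧ α.symm x ∈ H) →
    ∃ h, h ∈ H ∧ ∀ g, α g = h * g * h⁻¹

/-- The ball of radius `n` in `F_k`. -/
def ball (k n : ℕ) : Set (FreeGroup (Fin k)) := {g | wlen g ≤ n}

/-- The uniform probability measure on the ball of radius `n` in `F_k`. -/
noncomputable def unifBall (k n : ℕ) : Measure (FreeGroup (Fin k)) :=
  (Measure.count (ball k n))⁻¹ • (Measure.count.restrict (ball k n))

namespace RandomSubgroup

open FreeGroup

variable {k p : ℕ}

/-- The letters of the alphabet `X ∪ X⁻¹`. -/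
abbrev Letter (k : ℕ) := Fin k × Bool

/-- The inverse of a letter. -/
def linv (a : Letter k) : Letter k := (a.1, !a.2)

@[simp] lemma linv_linv (a : Letter k) : linv (linv a) = a := by simp [linv]

lemma linv_ne (a : Letter k) : linv a ≠ a := by
  intro h; have := congrArg Prod.snd h; simp [linv] at this

lemma linv_injective : Function.Injective (linv : Letter k → Letter k) := fun a b h => by
  rw [← linv_linv a, h, linv_linv]

lemma linv_eq_iff {a b : Letter k} : linv a = b ↔ a = linv b := by
  constructor <;> rintro rfl <;> simp

/-- The group element given by a letter. -/
def letter (a : Letter k) : FreeGroup (Fin k) := FreeGroup.mk [a]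

lemma letter_linv (a : Letter k) : letter (linv a) = (letter a)⁻¹ := by
  simp [letter, linv, FreeGroup.inv_mk, FreeGroup.invRev]

lemma invRev_cons' (a : Letter k) (l : List (Letter k)) :
    invRev (a :: l) = invRev l ++ [linv a] := by
  simp [invRev, linv]

lemma isReduced_cons {a : Letter k} {l : List (Letter k)} :
    IsReduced (a :: l) ↔ l.head? ≠ some (linv a) ∧ IsReduced l := by
  unfold FreeGroup.IsReduced
  rw [List.isChain_cons]
  refine and_congr_left fun _ => ?_
  cases l with
  | nil => simp
  | cons b l =>
    rcases a with ⟨a, _ | _⟩ <;> rcases b with ⟨b, _ | _⟩ <;>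
      simp [linv, @eq_comm _ a b]

lemma toWord_mk_of_isReduced {l : List (Letter k)} (h : IsReduced l) :
    (FreeGroup.mk l).toWord = l := by
  rw [toWord_mk, h.reduce_eq]

lemma mk_cons (a : Letter k) (l : List (Letter k)) :
    FreeGroup.mk (a :: l) = letter a * FreeGroup.mk l := by
  rw [letter, FreeGroup.mul_mk]; rfl

lemma mk_invRev (l : List (Letter k)) : FreeGroup.mk (invRev l) = (FreeGroup.mk l)⁻¹ :=
  FreeGroup.inv_mk.symm

lemma toWord_letter (a : Letter k) : (letter a).toWord = [a] :=
  toWord_mk_of_isReduced IsReduced.singleton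

lemma isReduced_append_cons {l r : List (Letter k)} {x y : Letter k}
    (h₁ : IsReduced (l ++ [x])) (h₂ : IsReduced (y :: r)) (h : y ≠ linv x) :
    IsReduced (l ++ [x] ++ y :: r) := by
  refine IsReduced.append_overlap h₁ ?_ (by simp)
  exact isReduced_cons.2 ⟨by simpa using h, h₂⟩

/-- The reduced word of a product is obtained by cancelling a suffix against a prefix. -/
lemma exists_cancel (g h : FreeGroup (Fin k)) :
    ∃ A c B, g.toWord = A ++ c ∧ h.toWord = invRev c ++ B ∧ (g * h).toWord = A ++ B := by
  suffices H : ∀ l : List (Letter k), IsReduced l →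
      ∃ A c B, l = A ++ c ∧ h.toWord = invRev c ++ B ∧ (FreeGroup.mk l * h).toWord = A ++ B by
    have := H g.toWord isReduced_toWord
    rwa [mk_toWord] at this
  intro l
  induction l with
  | nil => intro _; exact ⟨[], [], h.toWord, rfl, by simp, by simp [← FreeGroup.one_eq_mk]⟩
  | cons x l ih =>
    intro hl
    obtain ⟨hx, hl'⟩ := isReduced_cons.1 hl
    obtain ⟨A, c, B, rfl, hB, hAB⟩ := ih hl'
    rw [mk_cons, mul_assoc]
    have key : ∀ g : FreeGroup (Fin k), g.toWord.head? ≠ some (linv x) →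
        (letter x * g).toWord = x :: g.toWord := by
      intro g hg
      rw [← toWord_mk_of_isReduced (isReduced_cons.2 ⟨hg, isReduced_toWord⟩), mk_cons, mk_toWord]
    cases A with
    | cons a A =>
      refine ⟨x :: a :: A, c, B, rfl, hB, ?_⟩
      rw [key _ (by rw [hAB]; simpa using hx), hAB]; rfl
    | nil =>
      by_cases hb : B.head? = some (linv x)
      · obtain ⟨B', rfl⟩ : ∃ B', B = linv x :: B' := by
          cases B with
          | nil => simp at hb
          | cons b B => exact ⟨B, by simpa using hb⟩
        refine ⟨[], x :: c, B', rfl, by simp [hB, invRev_cons'], ?_⟩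
        have h1 : IsReduced (linv x :: B') := by
          have := hAB ▸ isReduced_toWord (x := FreeGroup.mk ([] ++ c) * h)
          simpa using this
        have h2 : FreeGroup.mk ([] ++ c) * h = letter (linv x) * FreeGroup.mk B' := by
          rw [← mk_cons, ← mk_toWord (x := _ * h), hAB]; rfl
        rw [h2, letter_linv, mul_inv_cancel_left, toWord_mk_of_isReduced (isReduced_cons.1 h1).2]
        rfl
      · refine ⟨[x], c, B, rfl, hB, ?_⟩
        rw [key _ (by rw [hAB]; simpa using hb), hAB]; rfl

lemma wlen_inv (g : FreeGroup (Fin k)) : wlen g⁻¹ = wlen g := FreeGroup.norm_inv_eq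

/-- The set of reduced words starting with the letter `s`. -/
def cyl (s : Letter k) : Set (FreeGroup (Fin k)) := {g | g.toWord.head? = some s}

lemma mem_cyl {s : Letter k} {g : FreeGroup (Fin k)} :
    g ∈ cyl s ↔ g.toWord.head? = some s := Iff.rfl

lemma letter_mem_cyl {a s : Letter k} : letter a ∈ cyl s ↔ a = s := by
  simp [mem_cyl, toWord_letter]

lemma one_notMem_cyl (s : Letter k) : (1 : FreeGroup (Fin k)) ∉ cyl s := by
  simp [mem_cyl]

lemma toWord_letter_mul {x : Letter k} {g : FreeGroup (Fin k)} (h : g ∉ cyl (linv x)) :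
    (letter x * g).toWord = x :: g.toWord := by
  rw [← toWord_mk_of_isReduced (isReduced_cons.2 ⟨h, isReduced_toWord⟩), mk_cons, mk_toWord]

lemma exists_mem_cyl {g : FreeGroup (Fin k)} (hg : g ≠ 1) : ∃ s, g ∈ cyl s := by
  cases h : g.toWord with
  | nil => exact absurd (toWord_eq_nil_iff.1 h) hg
  | cons s l => exact ⟨s, by simp [mem_cyl, h]⟩

lemma cyl_inj {s t : Letter k} {g : FreeGroup (Fin k)} (hs : g ∈ cyl s) (ht : g ∈ cyl t) :
    s = t := by
  rw [mem_cyl] at *; simpa [hs] using ht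

/-- Crossing the edge at the identity labelled `s`. -/
lemma letter_inv_mul_mem_cyl {s : Letter k} {g : FreeGroup (Fin k)} :
    (letter s)⁻¹ * g ∈ cyl (linv s) ↔ g ∉ cyl s := by
  constructor
  · intro h hg
    have h1 : (letter s)⁻¹ * g ∈ cyl (linv s) := h
    cases hw : g.toWord with
    | nil => simp [mem_cyl, hw] at hg
    | cons a l =>
      obtain rfl : a = s := by simpa [mem_cyl, hw] using hg
      have hr := isReduced_cons.1 (hw ▸ isReduced_toWord (x := g))
      have : g = letter a * FreeGroup.mk l := by rw [← mk_cons, ← hw, mk_toWord]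
      rw [this, inv_mul_cancel_left, mem_cyl, toWord_mk_of_isReduced hr.2] at h
      exact hr.1 h
  · intro h
    rw [← letter_linv, mem_cyl, toWord_letter_mul (by simpa using h)]
    rfl

/-- Right multiplication by a letter does not change the first letter, except at the identity. -/
lemma mul_letter_mem_cyl {s x : Letter k} {g : FreeGroup (Fin k)} (h1 : g ≠ 1)
    (h2 : g * letter x ≠ 1) : g * letter x ∈ cyl s ↔ g ∈ cyl s := by
  obtain ⟨A, c, B, hg, hx, hgx⟩ := exists_cancel g (letter x)
  rw [mem_cyl, mem_cyl, hg, hgx]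
  cases A with
  | cons a A => simp
  | nil =>
    rw [toWord_letter] at hx
    cases hc : invRev c with
    | nil =>
      have : c = [] := by rw [← invRev_invRev (L₁ := c), hc, invRev_empty]
      exact absurd (toWord_eq_nil_iff.1 (by simpa [this] using hg)) h1
    | cons a r =>
      rw [hc] at hx
      have : B = [] := by simp at hx; exact hx.2.2
      exact absurd (toWord_eq_nil_iff.1 (by simpa [this] using hgx)) h2

/-- The set of elements whose reduced word extends that of `u`. -/
def desc (u : FreeGroup (Fin k)) : Set (FreeGroup (Fin k)) := {g | u.toWord <+: g.toWord}

lemma mem_desc_iff {u g : FreeGroup (Fin k)} {x : Letter k}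
    (hx : u.toWord.getLast? = some x) : g ∈ desc u ↔ u⁻¹ * g ∉ cyl (linv x) := by
  obtain ⟨l, hl⟩ := List.getLast?_eq_some_iff.1 hx
  have hu : IsReduced (l ++ [x]) := hl ▸ isReduced_toWord
  constructor
  · rintro ⟨r, hr⟩ h
    have hg : g = u * FreeGroup.mk r := by
      rw [← mk_toWord (x := g), ← hr, ← FreeGroup.mul_mk, mk_toWord]
    rw [hl] at hr
    have hred : IsReduced (l ++ [x] ++ r) := hr ▸ isReduced_toWord
    have hred' : IsReduced (x :: r) := hred.infix ⟨l, [], by simp⟩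
    rw [hg, inv_mul_cancel_left, mem_cyl,
      toWord_mk_of_isReduced (isReduced_cons.1 hred').2] at h
    exact (isReduced_cons.1 hred').1 h
  · intro h
    have hr : IsReduced (l ++ [x] ++ (u⁻¹ * g).toWord) := by
      refine IsReduced.append_overlap hu ?_ (by simp)
      exact isReduced_cons.2 ⟨h, isReduced_toWord⟩
    refine ⟨(u⁻¹ * g).toWord, ?_⟩
    rw [hl, ← toWord_mk_of_isReduced hr, ← FreeGroup.mul_mk, ← hl, mk_toWord, mk_toWord,
      mul_inv_cancel_left]

/-- Equality of sets up to finitely many elements. -/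
def AEq {α : Type*} (A B : Set α) : Prop := {h | ¬(h ∈ A ↔ h ∈ B)}.Finite

lemma AEq.refl {α : Type*} (A : Set α) : AEq A A := by simp [AEq]

lemma AEq.symm {α : Type*} {A B : Set α} (h : AEq A B) : AEq B A :=
  Set.Finite.subset h fun x hx => by simp only [Set.mem_ofPred_eq] at *; tauto

lemma AEq.trans {α : Type*} {A B C : Set α} (h : AEq A B) (h' : AEq B C) : AEq A C :=
  (Set.Finite.union h h').subset fun x hx => by
    simp only [Set.mem_ofPred_eq, Set.mem_union] at *; tauto

lemma AEq.compl {α : Type*} {A B : Set α} (h : AEq A B) : AEq Aᶜ Bᶜ :=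
  Set.Finite.subset h fun x hx => by
    simp only [Set.mem_ofPred_eq, Set.mem_compl_iff] at *; tauto

lemma AEq.infinite {α : Type*} {A B : Set α} (h : AEq A B) (hA : A.Infinite) : B.Infinite := by
  intro hB
  refine hA ((hB.union h).subset fun x hx => ?_)
  simp only [Set.mem_ofPred_eq, Set.mem_union]; tauto

lemma AEq.preimage {α β : Type*} {A B : Set β} (e : α ≃ β) (h : AEq A B) :
    AEq (e ⁻¹' A) (e ⁻¹' B) :=
  Set.Finite.preimage e.injective.injOn h

/-- The left translate `gA`. -/
def tr (g : FreeGroup (Fin k)) (A : Set (FreeGroup (Fin k))) : Set (FreeGroup (Fin k)) :=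
  {h | g⁻¹ * h ∈ A}

lemma mem_tr {g h : FreeGroup (Fin k)} {A : Set (FreeGroup (Fin k))} :
    h ∈ tr g A ↔ g⁻¹ * h ∈ A := Iff.rfl

lemma tr_tr (g h : FreeGroup (Fin k)) (A : Set (FreeGroup (Fin k))) :
    tr g (tr h A) = tr (g * h) A := by
  ext x; simp [mem_tr, mul_assoc]

lemma tr_one (A : Set (FreeGroup (Fin k))) : tr 1 A = A := by
  ext x; simp [mem_tr]

lemma tr_compl (g : FreeGroup (Fin k)) (A : Set (FreeGroup (Fin k))) :
    tr g Aᶜ = (tr g A)ᶜ := rfl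

lemma AEq.tr {A B : Set (FreeGroup (Fin k))} (g : FreeGroup (Fin k)) (h : AEq A B) :
    AEq (tr g A) (tr g B) :=
  h.preimage (Equiv.mulLeft g⁻¹)

lemma tr_infinite {A : Set (FreeGroup (Fin k))} (g : FreeGroup (Fin k)) (h : A.Infinite) :
    (tr g A).Infinite := by
  have : tr g A = (g * ·) '' A := by
    ext x; simp only [mem_tr, Set.mem_image]
    exact ⟨fun hx => ⟨_, hx, by simp⟩, by rintro ⟨y, hy, rfl⟩; simpa⟩
  rw [this]
  exact h.image (mul_right_injective g).injOn

lemma compl_cyl (s : Letter k) : (cyl s)ᶜ = tr (letter s) (cyl (linv s)) := by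
  ext g; exact letter_inv_mul_mem_cyl.symm

/-- The set of `h` such that `A` separates `h` from `h * v`. -/
def crossing (A : Set (FreeGroup (Fin k))) (v : FreeGroup (Fin k)) : Set (FreeGroup (Fin k)) :=
  {h | ¬(h ∈ A ↔ h * v ∈ A)}

/-- The number of left translates of `A` separating `1` from `v`. -/
def cr (A : Set (FreeGroup (Fin k))) (v : FreeGroup (Fin k)) : ℕ := (crossing A v).ncard

/-- Almost invariant sets. -/
def AI (A : Set (FreeGroup (Fin k))) : Prop := ∀ v, (crossing A v).Finite

lemma crossing_compl (A : Set (FreeGroup (Fin k))) (v : FreeGroup (Fin k)) :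
    crossing Aᶜ v = crossing A v := by
  ext h; simp only [crossing, Set.mem_compl_iff, Set.mem_ofPred_eq]; tauto

lemma cr_compl (A : Set (FreeGroup (Fin k))) (v : FreeGroup (Fin k)) : cr Aᶜ v = cr A v := by
  rw [cr, cr, crossing_compl]

lemma AI.compl {A : Set (FreeGroup (Fin k))} (h : AI A) : AI Aᶜ := fun v => by
  rw [crossing_compl]; exact h v

lemma crossing_tr (A : Set (FreeGroup (Fin k))) (g v : FreeGroup (Fin k)) :
    crossing (tr g A) v = (g * ·) '' crossing A v := by
  ext h
  simp only [crossing, mem_tr, Set.mem_ofPred_eq, Set.mem_image]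
  constructor
  · intro hh; exact ⟨g⁻¹ * h, by simpa [mul_assoc] using hh, by simp⟩
  · rintro ⟨y, hy, rfl⟩; simpa [mul_assoc] using hy

lemma cr_tr (A : Set (FreeGroup (Fin k))) (g v : FreeGroup (Fin k)) :
    cr (tr g A) v = cr A v := by
  rw [cr, crossing_tr]
  exact Set.ncard_image_of_injective _ (mul_right_injective g)

lemma AI.tr {A : Set (FreeGroup (Fin k))} (g : FreeGroup (Fin k)) (h : AI A) : AI (tr g A) :=
  fun v => by rw [crossing_tr]; exact (h v).image _

lemma finite_preimage_mul_right {S : Set (FreeGroup (Fin k))} (hS : S.Finite)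
    (u : FreeGroup (Fin k)) : {h | h * u ∈ S}.Finite :=
  hS.preimage (mul_left_injective u).injOn

lemma ncard_preimage_mul_right (S : Set (FreeGroup (Fin k))) (u : FreeGroup (Fin k)) :
    {h | h * u ∈ S}.ncard = S.ncard :=
  Set.ncard_preimage_of_injective_subset_range (mul_left_injective u)
    (by rw [(Group.mulRight_bijective u).surjective.range_eq]; exact Set.subset_univ _)

lemma crossing_mul_subset (A : Set (FreeGroup (Fin k))) (u v : FreeGroup (Fin k)) :
    crossing A (u * v) ⊆ crossing A u ∪ {h | h * u ∈ crossing A v} := by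
  intro h hh
  simp only [crossing, Set.mem_ofPred_eq, Set.mem_union, ← mul_assoc] at *
  tauto

lemma AI.of_letter {A : Set (FreeGroup (Fin k))} (h : ∀ x, (crossing A (letter x)).Finite) :
    AI A := by
  intro v
  rw [← mk_toWord (x := v)]
  induction v.toWord with
  | nil => simp [crossing, ← FreeGroup.one_eq_mk]
  | cons x l ih =>
    rw [mk_cons]
    exact ((h x).union (finite_preimage_mul_right ih _)).subset (crossing_mul_subset _ _ _)

lemma cr_mul_le {A : Set (FreeGroup (Fin k))} (hA : AI A) (u v : FreeGroup (Fin k)) :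
    cr A (u * v) ≤ cr A u + cr A v := by
  refine (Set.ncard_le_ncard (crossing_mul_subset A u v)
    ((hA u).union (finite_preimage_mul_right (hA v) _))).trans ?_
  refine (Set.ncard_union_le _ _).trans_eq ?_
  rw [ncard_preimage_mul_right]; rfl

lemma crossing_subset_of_aeq (A B : Set (FreeGroup (Fin k))) (v : FreeGroup (Fin k)) :
    crossing A v ⊆ crossing B v ∪
      ({h | ¬(h ∈ A ↔ h ∈ B)} ∪ {h | h * v ∈ {h | ¬(h ∈ A ↔ h ∈ B)}}) := by
  intro h hh
  simp only [crossing, Set.mem_ofPred_eq, Set.mem_union] at *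
  tauto

lemma cr_le_of_aeq {A B : Set (FreeGroup (Fin k))} (hB : AI B) (h : AEq A B) :
    ∃ C : ℕ, ∀ v, cr A v ≤ cr B v + C := by
  refine ⟨2 * {h | ¬(h ∈ A ↔ h ∈ B)}.ncard, fun v => ?_⟩
  refine (Set.ncard_le_ncard (crossing_subset_of_aeq A B v)
    ((hB v).union (Set.Finite.union h (finite_preimage_mul_right h v)))).trans ?_
  refine (Set.ncard_union_le _ _).trans ?_
  have := Set.ncard_union_le {h | ¬(h ∈ A ↔ h ∈ B)} {h | h * v ∈ {h | ¬(h ∈ A ↔ h ∈ B)}}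
  rw [ncard_preimage_mul_right] at this
  unfold cr; omega

lemma crossing_cyl_letter_subset (s x : Letter k) :
    crossing (cyl s) (letter x) ⊆
      (if x = s then {1} else ∅) ∪ (if x = linv s then {(letter x)⁻¹} else ∅) := by
  intro h hh
  simp only [crossing, Set.mem_ofPred_eq] at hh
  by_cases h1 : h = 1
  · subst h1
    left
    have : x = s := by
      by_contra hne
      exact hh (by simp [one_notMem_cyl, letter_mem_cyl, hne])
    simp [this]
  · by_cases h2 : h * letter x = 1
    · right
      have h3 : h = (letter x)⁻¹ := eq_inv_of_mul_eq_one_left h2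
      have : x = linv s := by
        by_contra hne
        refine hh ?_
        rw [h2, h3, ← letter_linv, letter_mem_cyl]
        simp [one_notMem_cyl, linv_eq_iff, hne]
      simp [h3, this]
    · exact absurd (mul_letter_mem_cyl h1 h2).symm hh

lemma AI_cyl (s : Letter k) : AI (cyl s) := AI.of_letter fun x => by
  refine Set.Finite.subset ?_ (crossing_cyl_letter_subset s x)
  split_ifs <;> simp

lemma sum_cr_cyl_le (v : FreeGroup (Fin k)) : ∑ s, cr (cyl s) v ≤ 2 * wlen v := by
  have key : ∀ l : List (Letter k), ∑ s, cr (cyl s) (FreeGroup.mk l) ≤ 2 * l.length := by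
    intro l
    induction l with
    | nil => simp [cr, crossing, ← FreeGroup.one_eq_mk]
    | cons x l ih =>
      rw [mk_cons]
      calc ∑ s, cr (cyl s) (letter x * FreeGroup.mk l)
          ≤ ∑ s, (((if x = s then 1 else 0) + (if x = linv s then 1 else 0)) +
              cr (cyl s) (FreeGroup.mk l)) := by
            refine Finset.sum_le_sum fun s _ => (cr_mul_le (AI_cyl s) _ _).trans ?_
            refine Nat.add_le_add_right ?_ _
            refine (Set.ncard_le_ncard (crossing_cyl_letter_subset s x)
              (by split_ifs <;> simp)).trans ((Set.ncard_union_le _ _).trans ?_)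
            refine Nat.add_le_add ?_ ?_ <;> split_ifs <;> simp
        _ ≤ 2 * (x :: l).length := by
            rw [Finset.sum_add_distrib, Finset.sum_add_distrib]
            simp only [← linv_eq_iff, Finset.sum_ite_eq, Finset.mem_univ, if_true,
              List.length_cons]
            omega
  have := key v.toWord
  rwa [mk_toWord] at this

/-- The number of occurrences of `ab` as a subword. -/
def cnt (a b : Letter k) : List (Letter k) → ℕ
  | [] => 0
  | x :: l => cnt a b l + if x = a ∧ l.head? = some b then 1 else 0

/-- The set of `h` such that the path from `h` to `h * v` goes from the `a` side of the identity
to the `b` side. -/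
def turns (a b : Letter k) (v : FreeGroup (Fin k)) : Set (FreeGroup (Fin k)) :=
  {h | h ∈ cyl a ∧ h * v ∈ cyl b}

lemma turns_finite_ncard {a b : Letter k} (hab : a ≠ b) (v : FreeGroup (Fin k)) :
    (turns a b v).Finite ∧ (turns a b v).ncard = cnt (linv a) b v.toWord := by
  have key : ∀ l : List (Letter k), IsReduced l → (turns a b (FreeGroup.mk l)).Finite ∧
      (turns a b (FreeGroup.mk l)).ncard = cnt (linv a) b l := by
    intro l
    induction l with
    | nil =>
      intro _
      have : turns a b (FreeGroup.mk []) = ∅ := by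
        ext h
        simp only [turns, ← FreeGroup.one_eq_mk, mul_one, Set.mem_ofPred_eq,
          Set.mem_empty_iff_false, iff_false]
        exact fun hh => hab (cyl_inj hh.1 hh.2)
      simp [this, cnt]
    | cons x l ih =>
      intro hl
      obtain ⟨hx, hl'⟩ := isReduced_cons.1 hl
      obtain ⟨hf, hn⟩ := ih hl'
      have hhead : ∀ t, FreeGroup.mk l ∈ cyl t ↔ l.head? = some t := fun t => by
        rw [mem_cyl, toWord_mk_of_isReduced hl']
      have hset : turns a b (FreeGroup.mk (x :: l)) = {h | h * letter x ∈
          turns a b (FreeGroup.mk l) ∪ if x = linv a ∧ l.head? = some b then {1} else ∅} := by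
        ext h
        rw [mk_cons]
        simp only [turns, Set.mem_ofPred_eq, ← mul_assoc, Set.mem_union]
        by_cases h1 : h = 1
        · subst h1
          have : letter x ∈ cyl a → letter x * FreeGroup.mk l ∉ cyl b := by
            rw [letter_mem_cyl]; rintro rfl hb
            rw [mem_cyl, ← mk_cons, toWord_mk_of_isReduced hl] at hb
            exact hab (by simpa using hb)
          have h3 : letter x ≠ 1 := fun h => by
            have := toWord_letter x; rw [h] at this; simp at this
          have h4 : letter x ∉ (if x = linv a ∧ l.head? = some b then {1} else ∅ :
              Set (FreeGroup (Fin k))) := by split_ifs <;> simp [h3]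
          simp only [one_notMem_cyl, one_mul, false_and, false_iff]
          tauto
        · by_cases h2 : h * letter x = 1
          · have h3 : h = letter (linv x) := by
              rw [letter_linv]; exact eq_inv_of_mul_eq_one_left h2
            simp only [h2, one_notMem_cyl, one_mul, false_and, false_or]
            rw [h3, letter_mem_cyl, hhead, linv_eq_iff]
            split_ifs with h5 <;> simp [h5]
          · rw [← mul_letter_mem_cyl h1 h2]
            have : h * letter x ∉ (if x = linv a ∧ l.head? = some b then {1} else ∅ :
                Set (FreeGroup (Fin k))) := by split_ifs <;> simp [h2]
            tauto
      have hdis : Disjoint (turns a b (FreeGroup.mk l))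
          (if x = linv a ∧ l.head? = some b then {1} else ∅) := by
        split_ifs
        · simp [turns, one_notMem_cyl]
        · simp
      have hfin : (if x = linv a ∧ l.head? = some b then {1} else ∅ :
          Set (FreeGroup (Fin k))).Finite := by split_ifs <;> simp
      refine ⟨hset ▸ finite_preimage_mul_right (hf.union hfin) _, ?_⟩
      rw [hset, ncard_preimage_mul_right, Set.ncard_union_eq hdis hf hfin, hn, cnt]
      congr 1
      split_ifs <;> simp
  have := key v.toWord isReduced_toWord
  rwa [mk_toWord] at this

/-- The average number of occurrences in `v` of a given reduced two-letter word. -/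
def tau (v : FreeGroup (Fin k)) : ℝ := wlen v / (2 * k * (2 * k - 1))

lemma tau_nonneg (v : FreeGroup (Fin k)) : 0 ≤ tau v := by
  unfold tau
  rcases Nat.eq_zero_or_pos k with rfl | hk
  · simp
  · have : (1 : ℝ) ≤ k := by exact_mod_cast hk
    have : (0 : ℝ) ≤ 2 * k - 1 := by linarith
    positivity

/-- All reduced two-letter words occur in `v` with frequencies that are uniform up to a relative
error `ε`. -/
def Unif (ε : ℝ) (v : FreeGroup (Fin k)) : Prop :=
  ∀ a b, b ≠ linv a → |(cnt a b v.toWord : ℝ) - tau v| ≤ ε * tau v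

/-- The union of the sets `turns a b v` over a set of pairs of letters. -/
def manyTurns (P : Finset (Letter k × Letter k)) (v : FreeGroup (Fin k)) :
    Set (FreeGroup (Fin k)) := {h | ∃ p ∈ P, h ∈ turns p.1 p.2 v}

lemma manyTurns_finite_ncard (P : Finset (Letter k × Letter k)) (hP : ∀ p ∈ P, p.1 ≠ p.2)
    (v : FreeGroup (Fin k)) : (manyTurns P v).Finite ∧
      (manyTurns P v).ncard = ∑ p ∈ P, cnt (linv p.1) p.2 v.toWord := by
  induction P using Finset.induction_on with
  | empty => simp [manyTurns]
  | insert p P hp ih =>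
    obtain ⟨hf, hn⟩ := ih fun q hq => hP q (Finset.mem_insert_of_mem hq)
    obtain ⟨hf', hn'⟩ := turns_finite_ncard (hP p (Finset.mem_insert_self _ _)) v
    have hset : manyTurns (insert p P) v = turns p.1 p.2 v ∪ manyTurns P v := by
      ext h; simp [manyTurns]
    have hdis : Disjoint (turns p.1 p.2 v) (manyTurns P v) := by
      rw [Set.disjoint_left]
      rintro h h1 ⟨q, hq, h2⟩
      obtain rfl : p = q := Prod.ext (cyl_inj h1.1 h2.1) (cyl_inj h1.2 h2.2)
      exact hp hq
    rw [hset, Set.ncard_union_eq hdis hf' hf, Finset.sum_insert hp, hn, hn']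
    exact ⟨hf'.union hf, rfl⟩

lemma Unif.abs_manyTurns_sub_le {ε : ℝ} {v : FreeGroup (Fin k)} (hv : Unif ε v)
    (P : Finset (Letter k × Letter k)) (hP : ∀ p ∈ P, p.1 ≠ p.2) :
    |((manyTurns P v).ncard : ℝ) - P.card * tau v| ≤ P.card * (ε * tau v) := by
  rw [(manyTurns_finite_ncard P hP v).2, ← nsmul_eq_mul, ← Finset.sum_const, Nat.cast_sum,
    ← Finset.sum_sub_distrib, ← nsmul_eq_mul, ← Finset.sum_const]
  refine (Finset.abs_sum_le_sum_abs _ _).trans (Finset.sum_le_sum fun p hp => ?_)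
  exact hv _ _ (by simpa using (hP p hp).symm)

/-- `A` is a half-tree up to a finite set. -/
def Half (A : Set (FreeGroup (Fin k))) : Prop := ∃ g s, AEq A (tr g (cyl s))

lemma Half.of_aeq {A B : Set (FreeGroup (Fin k))} (h : Half A) (hAB : AEq A B) : Half B := by
  obtain ⟨g, s, hg⟩ := h
  exact ⟨g, s, hAB.symm.trans hg⟩

lemma Half.compl {A : Set (FreeGroup (Fin k))} (h : Half A) : Half Aᶜ := by
  obtain ⟨g, s, hg⟩ := h
  refine ⟨g * letter s, linv s, ?_⟩
  rw [← tr_tr, ← compl_cyl, tr_compl]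
  exact hg.compl

lemma Half.tr {A : Set (FreeGroup (Fin k))} (h : Half A) (u : FreeGroup (Fin k)) :
    Half (tr u A) := by
  obtain ⟨g, s, hg⟩ := h
  exact ⟨u * g, s, by rw [← tr_tr]; exact hg.tr u⟩

open Classical in
/-- The lower bound for the number of translates of `A` crossed, per unit of `tau`. -/
def rate (ε : ℝ) (A : Set (FreeGroup (Fin k))) : ℝ :=
  2 * (2 * k - 1) * (1 - ε) + if Half A then 0 else 2 * (1 - 3 * ε)

lemma rate_congr {ε : ℝ} {A B : Set (FreeGroup (Fin k))} (h : Half A ↔ Half B) :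
    rate ε A = rate ε B := by
  classical
  unfold rate
  rw [if_congr h rfl rfl]

/-- Words with uniform two-letter frequencies cross many translates of `A`. -/
def Bd (ε : ℝ) (A : Set (FreeGroup (Fin k))) : Prop :=
  ∃ C : ℝ, ∀ v, Unif ε v → rate ε A * tau v - C ≤ cr A v

lemma Bd.of_aeq {ε : ℝ} {A B : Set (FreeGroup (Fin k))} (h : Bd ε A) (hB : AI B)
    (hAB : AEq A B) : Bd ε B := by
  obtain ⟨C, hC⟩ := h
  obtain ⟨D, hD⟩ := cr_le_of_aeq hB hAB
  have hr : rate ε B = rate ε A := by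
    have : Half B ↔ Half A := ⟨fun h => h.of_aeq hAB.symm, fun h => h.of_aeq hAB⟩
    exact rate_congr this
  refine ⟨C + D, fun v hv => ?_⟩
  have h1 := hC v hv
  have h2 : (cr A v : ℝ) ≤ cr B v + D := by exact_mod_cast hD v
  rw [hr]; linarith

lemma Bd.of_compl {ε : ℝ} {A : Set (FreeGroup (Fin k))} (h : Bd ε Aᶜ) : Bd ε A := by
  obtain ⟨C, hC⟩ := h
  have hr : rate ε Aᶜ = rate ε A := by
    have : Half Aᶜ ↔ Half A := ⟨fun h => compl_compl A ▸ h.compl, Half.compl⟩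
    exact rate_congr this
  exact ⟨C, fun v hv => by rw [← hr, ← cr_compl]; exact hC v hv⟩

lemma Bd.tr {ε : ℝ} {A : Set (FreeGroup (Fin k))} (h : Bd ε A) (g : FreeGroup (Fin k)) :
    Bd ε (tr g A) := by
  obtain ⟨C, hC⟩ := h
  have hr : rate ε (RandomSubgroup.tr g A) = rate ε A := by
    have : Half (RandomSubgroup.tr g A) ↔ Half A :=
      ⟨fun h => by simpa [tr_tr, tr_one] using h.tr g⁻¹, fun h => h.tr g⟩
    exact rate_congr this
  exact ⟨C, fun v hv => by rw [hr, cr_tr]; exact hC v hv⟩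

/-- The union of the sets `cyl s` for `s ∈ I`. -/
def cylU (I : Finset (Letter k)) : Set (FreeGroup (Fin k)) := {h | ∃ s ∈ I, h ∈ cyl s}

lemma AI_cylU (I : Finset (Letter k)) : AI (cylU I) := by
  intro v
  refine (Set.Finite.biUnion (Finset.finite_toSet I) fun s _ => AI_cyl s v).subset ?_
  intro h hh
  simp only [crossing, cylU, Set.mem_ofPred_eq, Set.mem_iUnion, Finset.mem_coe] at *
  by_contra hcon
  push Not at hcon
  exact hh ⟨fun ⟨s, hs, h1⟩ => ⟨s, hs, (hcon s hs).1 h1⟩,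
    fun ⟨s, hs, h1⟩ => ⟨s, hs, (hcon s hs).2 h1⟩⟩

lemma card_letter : Fintype.card (Letter k) = 2 * k := by
  simp [Letter, mul_comm]

lemma cr_cylU_ge {ε : ℝ} {v : FreeGroup (Fin k)} (hv : Unif ε v) (I : Finset (Letter k)) :
    2 * I.card * (2 * k - I.card) * ((1 - ε) * tau v) ≤ cr (cylU I) v := by
  have hP : ∀ p ∈ I ×ˢ Iᶜ ∪ Iᶜ ×ˢ I, p.1 ≠ p.2 := by
    rintro ⟨a, b⟩ hp (hab : a = b)
    subst hab
    simp at hp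
  have h1 := hv.abs_manyTurns_sub_le _ hP
  have hdis : Disjoint (I ×ˢ Iᶜ) (Iᶜ ×ˢ I) := by
    rw [Finset.disjoint_left]; rintro ⟨a, b⟩; simp; tauto
  have hcard : (((I ×ˢ Iᶜ ∪ Iᶜ ×ˢ I).card : ℕ) : ℝ) = 2 * I.card * (2 * k - I.card) := by
    rw [Finset.card_union_of_disjoint hdis, Finset.card_product, Finset.card_product]
    have : (Iᶜ.card : ℝ) = 2 * k - I.card := by
      rw [Finset.card_compl, Nat.cast_sub (Finset.card_le_univ I), card_letter]; push_cast; ring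
    push_cast; rw [this]; ring
  rw [hcard] at h1
  have h2 : ((manyTurns (I ×ˢ Iᶜ ∪ Iᶜ ×ˢ I) v).ncard : ℝ) ≤ cr (cylU I) v := by
    refine Nat.cast_le.2 (Set.ncard_le_ncard ?_ (AI_cylU I v))
    rintro h ⟨⟨a, b⟩, hp, h1, h2⟩
    simp only [Finset.mem_union, Finset.mem_product, Finset.mem_compl] at hp
    simp only [crossing, cylU, Set.mem_ofPred_eq]
    rcases hp with ⟨ha, hb⟩ | ⟨ha, hb⟩
    · exact fun hh => by
        obtain ⟨s, hs, h3⟩ := hh.1 ⟨a, ha, h1⟩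
        obtain rfl : b = s := cyl_inj h2 h3
        exact hb hs
    · exact fun hh => by
        obtain ⟨s, hs, h3⟩ := hh.2 ⟨b, hb, h2⟩
        obtain rfl : a = s := cyl_inj h1 h3
        exact ha hs
  have := (abs_le.1 h1).1
  nlinarith

lemma cylU_half_of_card_eq_one {I : Finset (Letter k)} (h : I.card = 1) : Half (cylU I) := by
  obtain ⟨s, rfl⟩ := Finset.card_eq_one.1 h
  refine ⟨1, s, ?_⟩
  rw [tr_one]
  convert AEq.refl _ using 1
  ext; simp [cylU]

lemma aeq_compl_cylU (I : Finset (Letter k)) : AEq (cylU I)ᶜ (cylU Iᶜ) := by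
  refine (Set.finite_singleton (1 : FreeGroup (Fin k))).subset fun h hh => ?_
  by_contra h1
  obtain ⟨s, hs⟩ := exists_mem_cyl h1
  have key : ∀ J : Finset (Letter k), h ∈ cylU J ↔ s ∈ J := fun J =>
    ⟨fun ⟨t, ht, h2⟩ => cyl_inj hs h2 ▸ ht, fun h => ⟨s, h, hs⟩⟩
  simp [key] at hh

lemma Bd_cylU {ε : ℝ} (hε : 0 ≤ ε) (hε' : ε ≤ 1 / 3) {I : Finset (Letter k)}
    (hI : 0 < I.card) (hI' : I.card < 2 * k) : Bd ε (cylU I) := by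
  refine ⟨0, fun v hv => ?_⟩
  rw [sub_zero]
  refine le_trans ?_ (cr_cylU_ge hv I)
  have h1 : (1 : ℝ) ≤ I.card := by exact_mod_cast hI
  have h2 : (I.card : ℝ) + 1 ≤ 2 * k := by exact_mod_cast hI'
  have h0 := tau_nonneg v
  rw [← mul_assoc]
  refine mul_le_mul_of_nonneg_right ?_ h0
  unfold rate
  split_ifs with hH
  · nlinarith [mul_nonneg (sub_nonneg.2 h1) (sub_nonneg.2 h2)]
  · have h3 : I.card ≠ 1 := fun h => hH (cylU_half_of_card_eq_one h)
    have h4 : I.card ≠ 2 * k - 1 := fun h => by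
      refine hH ?_
      have h5 : Iᶜ.card = 1 := by rw [Finset.card_compl, card_letter]; omega
      rw [← compl_compl (cylU I)]
      exact ((cylU_half_of_card_eq_one h5).of_aeq (aeq_compl_cylU I).symm).compl
    have h5 : (2 : ℝ) ≤ I.card := by exact_mod_cast (by omega : 2 ≤ I.card)
    have h6 : (I.card : ℝ) + 2 ≤ 2 * k := by exact_mod_cast (by omega : I.card + 2 ≤ 2 * k)
    nlinarith [mul_nonneg (sub_nonneg.2 h5) (sub_nonneg.2 h6)]

/-- Forgetting the part `I` of `A` in a neighbourhood of the identity where `A` is constant on all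
but one of the directions. -/
lemma cr_inter_cyl_le {ε : ℝ} {v : FreeGroup (Fin k)} (hv : Unif ε v)
    {A : Set (FreeGroup (Fin k))} (hA : AI A) {t : Letter k} {I J : Finset (Letter k)}
    (hI : ∀ s ∈ I, cyl s ⊆ A) (hJ : ∀ s ∈ J, Disjoint (cyl s) A) (htI : t ∉ I)
    (hU : ∀ s, s ≠ t → s ∈ I ∨ s ∈ J) (htJ : t ∉ J) (hIJ : Disjoint I J) :
    cr (A ∩ cyl t) v + 2 * I.card * J.card * ((1 - ε) * tau v) ≤
      cr A v + 2 * I.card * ((1 + ε) * tau v) + 2 := by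
  have hIJ' : ∀ s, s ∈ I → s ∉ J := fun s hs => Finset.disjoint_left.1 hIJ hs
  have hP : ∀ p ∈ I ×ˢ J ∪ J ×ˢ I, p.1 ≠ p.2 := by
    rintro ⟨a, b⟩ hp (hab : a = b)
    subst hab
    simp only [Finset.mem_union, Finset.mem_product] at hp
    have := hIJ' a; tauto
  have hQ : ∀ p ∈ I ×ˢ {t} ∪ {t} ×ˢ I, p.1 ≠ p.2 := by
    rintro ⟨a, b⟩ hp (hab : a = b)
    subst hab
    simp only [Finset.mem_union, Finset.mem_product, Finset.mem_singleton] at hp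
    rcases hp with ⟨h, rfl⟩ | ⟨rfl, h⟩ <;> exact htI h
  have hPc : (((I ×ˢ J ∪ J ×ˢ I).card : ℕ) : ℝ) = 2 * I.card * J.card := by
    rw [Finset.card_union_of_disjoint, Finset.card_product, Finset.card_product]
    · push_cast; ring
    · rw [Finset.disjoint_left]; rintro ⟨a, b⟩
      simp only [Finset.mem_product]
      have := hIJ' a; tauto
  have hQc : (((I ×ˢ {t} ∪ {t} ×ˢ I).card : ℕ) : ℝ) ≤ 2 * I.card := by
    have := Finset.card_union_le (I ×ˢ {t}) ({t} ×ˢ I)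
    rw [Finset.card_product, Finset.card_product, Finset.card_singleton] at this
    have h2 : (I ×ˢ {t} ∪ {t} ×ˢ I).card ≤ 2 * I.card := by omega
    exact_mod_cast h2
  have hPb := hv.abs_manyTurns_sub_le _ hP
  have hQb := hv.abs_manyTurns_sub_le _ hQ
  have hPf := (manyTurns_finite_ncard _ hP v).1
  have hQf := (manyTurns_finite_ncard _ hQ v).1
  have hmemI : ∀ h s, h ∈ cyl s → s ∈ I → h ∈ A := fun h s hs hs' => hI s hs' hs
  have hmemJ : ∀ h s, h ∈ cyl s → s ∈ J → h ∉ A := fun h s hs hs' =>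
    Set.disjoint_left.1 (hJ s hs') hs
  have hmemt : ∀ h s, h ∈ cyl s → h ∈ cyl t → s = t := fun h s => cyl_inj
  have hAf : (crossing (A ∩ cyl t) v).Finite := by
    refine ((hA v).union (AI_cyl t v)).subset fun h hh => ?_
    simp only [crossing, Set.mem_inter_iff, Set.mem_ofPred_eq, Set.mem_union] at *
    tauto
  have hdis : Disjoint (crossing (A ∩ cyl t) v) (manyTurns (I ×ˢ J ∪ J ×ˢ I) v) := by
    rw [Set.disjoint_right]
    rintro h ⟨⟨a, b⟩, hp, h1, h2⟩ hc
    have hat : h ∉ cyl t := fun h3 => by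
      obtain rfl := hmemt _ _ h1 h3
      simp only [Finset.mem_union, Finset.mem_product] at hp; tauto
    have hbt : h * v ∉ cyl t := fun h3 => by
      obtain rfl := hmemt _ _ h2 h3
      simp only [Finset.mem_union, Finset.mem_product] at hp; tauto
    simp [crossing, hat, hbt] at hc
  have hsub : crossing (A ∩ cyl t) v ∪ manyTurns (I ×ˢ J ∪ J ×ˢ I) v ⊆
      crossing A v ∪ manyTurns (I ×ˢ {t} ∪ {t} ×ˢ I) v ∪ {1, v⁻¹} := by
    rintro h (hh | ⟨⟨a, b⟩, hp, h1, h2⟩)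
    · by_cases e1 : h = 1
      · right; simp [e1]
      by_cases e2 : h * v = 1
      · right; simp [eq_inv_of_mul_eq_one_left e2]
      left
      obtain ⟨a, ha⟩ := exists_mem_cyl e1
      obtain ⟨b, hb⟩ := exists_mem_cyl e2
      by_cases hc : h ∈ crossing A v
      · exact Or.inl hc
      right
      simp only [crossing, Set.mem_ofPred_eq, not_not, Set.mem_inter_iff] at hc hh
      by_cases hat : a = t
      · subst hat
        by_cases hbt : b = a
        · subst hbt; tauto
        have hbt' : h * v ∉ cyl a := fun h3 => hbt (cyl_inj hb h3)
        have hbI : b ∈ I := by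
          rcases hU b hbt with h | h
          · exact h
          · have := hmemJ _ _ hb h; tauto
        exact ⟨(a, b), by simp [hbI], ha, hb⟩
      · have hat' : h ∉ cyl t := fun h3 => hat (cyl_inj ha h3)
        have hbt : h * v ∈ cyl t := by tauto
        obtain rfl : b = t := cyl_inj hb hbt
        have haI : a ∈ I := by
          rcases hU a hat with h | h
          · exact h
          · have := hmemJ _ _ ha h; tauto
        exact ⟨(a, b), by simp [haI], ha, hb⟩
    · left; left
      simp only [Finset.mem_union, Finset.mem_product] at hp
      simp only [crossing, Set.mem_ofPred_eq]
      rcases hp with ⟨ha, hb⟩ | ⟨ha, hb⟩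
      · have := hmemI _ _ h1 ha; have := hmemJ _ _ h2 hb; tauto
      · have := hmemJ _ _ h1 ha; have := hmemI _ _ h2 hb; tauto
  have hle := Set.ncard_le_ncard hsub (((hA v).union hQf).union (by simp))
  rw [Set.ncard_union_eq hdis hAf hPf] at hle
  have h3 := (Set.ncard_union_le (crossing A v ∪ manyTurns (I ×ˢ {t} ∪ {t} ×ˢ I) v) {1, v⁻¹})
  have h4 := (Set.ncard_union_le (crossing A v) (manyTurns (I ×ˢ {t} ∪ {t} ×ˢ I) v))
  have h5 := Set.ncard_insert_le (1 : FreeGroup (Fin k)) {v⁻¹}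
  rw [Set.ncard_singleton] at h5
  have h6 : (cr (A ∩ cyl t) v : ℝ) + (manyTurns (I ×ˢ J ∪ J ×ˢ I) v).ncard ≤
      cr A v + (manyTurns (I ×ˢ {t} ∪ {t} ×ˢ I) v).ncard + 2 := by
    unfold cr; exact_mod_cast (by omega)
  have h7 := (abs_le.1 hPb).1
  have h8 := (abs_le.1 hQb).2
  rw [hPc] at h7
  have h9 : ((manyTurns (I ×ˢ {t} ∪ {t} ×ˢ I) v).ncard : ℝ) ≤
      ((I ×ˢ {t} ∪ {t} ×ˢ I).card : ℝ) * ((1 + ε) * tau v) := by linarith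
  have hnn : ((I ×ˢ {t} ∪ {t} ×ˢ I).card : ℝ) * ((1 + ε) * tau v) ≤
      2 * I.card * ((1 + ε) * tau v) := by
    rcases le_or_gt 0 ((1 + ε) * tau v) with h | h
    · exact mul_le_mul_of_nonneg_right hQc h
    · rcases Finset.eq_empty_or_nonempty I with rfl | hne
      · simp
      · have h10 : (0 : ℝ) ≤ ((manyTurns (I ×ˢ {t} ∪ {t} ×ˢ I) v).ncard : ℝ) := by positivity
        have h11 : (0 : ℝ) < ((I ×ˢ {t} ∪ {t} ×ˢ I).card : ℝ) := by
          obtain ⟨s, hs⟩ := hne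
          exact_mod_cast Finset.card_pos.2 ⟨(s, t), by simp [hs]⟩
        nlinarith
  linarith

lemma Bd_of_inter {ε : ℝ} (hε : 0 ≤ ε) (hε' : ε ≤ 1 / 3) {A : Set (FreeGroup (Fin k))}
    (hA : AI A) (hAinf : A.Infinite) {t : Letter k} {I J : Finset (Letter k)}
    (hI : ∀ s ∈ I, cyl s ⊆ A) (hJ : ∀ s ∈ J, Disjoint (cyl s) A) (htI : t ∉ I)
    (hU : ∀ s, s ≠ t → s ∈ I ∨ s ∈ J) (htJ : t ∉ J) (hIJ : Disjoint I J)
    (hlt : I.card < J.card) (hJ2 : 2 ≤ J.card)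
    (hrec : (A ∩ cyl t).Infinite → Bd ε (A ∩ cyl t)) : Bd ε A := by
  have hbase : ∀ h ∈ A, h ≠ 1 → h ∉ cyl t → ∃ s ∈ I, h ∈ cyl s := by
    intro h hh h1 ht
    obtain ⟨s, hs⟩ := exists_mem_cyl h1
    rcases hU s (fun e => ht (e ▸ hs)) with h2 | h2
    · exact ⟨s, h2, hs⟩
    · exact absurd hh (Set.disjoint_left.1 (hJ s h2) hs)
  by_cases hinf : (A ∩ cyl t).Infinite
  · have hB := hrec hinf
    rcases Finset.eq_empty_or_nonempty I with rfl | hne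
    · refine hB.of_aeq hA ((Set.finite_singleton (1 : FreeGroup (Fin k))).subset fun h hh => ?_)
      by_contra h1
      have := hbase h
      simp only [Set.mem_inter_iff, Set.mem_ofPred_eq, Finset.notMem_empty, false_and,
        exists_false] at *
      tauto
    · obtain ⟨C, hC⟩ := hB
      refine ⟨C + 2, fun v hv => ?_⟩
      have h1 := hC v hv
      have h2 := cr_inter_cyl_le hv hA hI hJ htI hU htJ hIJ
      have h3 : (1 : ℝ) ≤ I.card := by exact_mod_cast hne.card_pos
      have h4 : (2 : ℝ) ≤ J.card := by exact_mod_cast hJ2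
      have h0 := tau_nonneg v
      have h5 : rate ε A ≤ rate ε (A ∩ cyl t) + 2 * (1 - 3 * ε) := by
        unfold rate; split_ifs <;> linarith
      have h6 : 2 * (1 - 3 * ε) ≤ 2 * I.card * J.card * (1 - ε) - 2 * I.card * (1 + ε) := by
        have : 1 - 3 * ε ≤ J.card * (1 - ε) - (1 + ε) := by nlinarith
        nlinarith
      have h7 := mul_le_mul_of_nonneg_right h5 h0
      have h8 := mul_le_mul_of_nonneg_right h6 h0
      linarith
  · rw [Set.not_infinite] at hinf
    have haeq : AEq (cylU I) A := by
      refine (hinf.union (Set.finite_singleton 1)).subset fun h hh => ?_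
      by_contra h1
      simp only [Set.mem_union, Set.mem_inter_iff, Set.mem_singleton_iff, not_or] at h1
      refine hh ⟨fun ⟨s, hs, h2⟩ => hI s hs h2, fun h2 => hbase h h2 h1.2 fun h3 => h1.1 ⟨h2, h3⟩⟩
    refine (Bd_cylU hε hε' ?_ ?_).of_aeq hA haeq
    · by_contra h0
      have : I = ∅ := by simpa using h0
      subst this
      refine haeq.symm.infinite hAinf ?_
      simp [cylU]
    · have := Finset.card_lt_univ_of_notMem htI
      rwa [card_letter] at this

lemma toWord_mul_of_getLast {u h : FreeGroup (Fin k)} {x : Letter k}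
    (hx : u.toWord.getLast? = some x) (hh : h ∉ cyl (linv x)) :
    (u * h).toWord = u.toWord ++ h.toWord := by
  obtain ⟨l, hl⟩ := List.getLast?_eq_some_iff.1 hx
  have hu : IsReduced (l ++ [x]) := hl ▸ isReduced_toWord
  have hr : IsReduced (u.toWord ++ h.toWord) := by
    cases hw : h.toWord with
    | nil => simpa using (isReduced_toWord : IsReduced u.toWord)
    | cons y r =>
      rw [hl]
      refine isReduced_append_cons hu (hw ▸ isReduced_toWord) fun e => hh ?_
      rw [mem_cyl, hw, e]; rfl
  rw [← toWord_mk_of_isReduced hr, ← FreeGroup.mul_mk, mk_toWord, mk_toWord]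

/-- The set `A` is constant on the descendants of `u`. -/
def ConstOn (A : Set (FreeGroup (Fin k))) (u : FreeGroup (Fin k)) : Prop :=
  ∀ g ∈ desc u, (g ∈ A ↔ u ∈ A)

/-- The set `A` only depends on the first `n` letters. -/
def Level (n : ℕ) (A : Set (FreeGroup (Fin k))) : Prop := ∀ u, wlen u = n → ConstOn A u

lemma ConstOn.compl {A : Set (FreeGroup (Fin k))} {u : FreeGroup (Fin k)} (h : ConstOn A u) :
    ConstOn Aᶜ u := fun g hg => not_congr (h g hg)

lemma AI.exists_level {A : Set (FreeGroup (Fin k))} (hA : AI A) : ∃ n, Level n A := by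
  have hfin : (⋃ x, crossing A (letter x)).Finite := Set.finite_iUnion fun x => hA _
  obtain ⟨n, hn⟩ := (hfin.image wlen).bddAbove
  refine ⟨n + 1, fun u hu g hg => ?_⟩
  obtain ⟨r, hr⟩ := hg
  have key : ∀ r : List (Letter k), IsReduced (u.toWord ++ r) →
      (FreeGroup.mk (u.toWord ++ r) ∈ A ↔ u ∈ A) := by
    intro r
    induction r using List.reverseRecOn with
    | nil => intro _; rw [List.append_nil, mk_toWord]
    | append_singleton r x ih =>
      intro hred
      rw [← List.append_assoc] at hred
      have h1 : IsReduced (u.toWord ++ r) := hred.infix ⟨[], [x], by simp⟩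
      rw [← ih h1, ← List.append_assoc, ← FreeGroup.mul_mk]
      by_contra hcon
      have h2 : FreeGroup.mk (u.toWord ++ r) ∈ crossing A (letter x) := fun h => hcon h.symm
      have h3 := hn ⟨_, Set.mem_iUnion.2 ⟨x, h2⟩, rfl⟩
      unfold wlen at h3 hu
      rw [toWord_mk_of_isReduced h1, List.length_append] at h3
      omega
  have h1 := key r (hr ▸ isReduced_toWord)
  rwa [hr, mk_toWord] at h1

lemma finite_sphere (n : ℕ) : {u : FreeGroup (Fin k) | wlen u = n}.Finite :=
  Set.Finite.preimage (f := FreeGroup.toWord) toWord_injective.injOn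
    (List.finite_length_eq (Letter k) n)

lemma self_mem_desc (u : FreeGroup (Fin k)) : u ∈ desc u := List.prefix_refl _

lemma mem_desc_congr {u w g : FreeGroup (Fin k)} (h : wlen u ≤ wlen w) (hg : g ∈ desc w) :
    g ∈ desc u ↔ w ∈ desc u :=
  ⟨fun h1 => List.prefix_of_prefix_length_le h1 hg h, fun h1 => List.IsPrefix.trans h1 hg⟩

lemma ConstOn.diff {A : Set (FreeGroup (Fin k))} {u w : FreeGroup (Fin k)} (h : ConstOn A w)
    (hw : wlen u ≤ wlen w) : ConstOn (A \ desc u) w := fun g hg => by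
  rw [Set.mem_sdiff, Set.mem_sdiff, h g hg, mem_desc_congr hw hg]

lemma constOn_diff_self (A : Set (FreeGroup (Fin k))) (u : FreeGroup (Fin k)) :
    ConstOn (A \ desc u) u := fun g hg => by simp [hg, self_mem_desc]

lemma AI.inter {A B : Set (FreeGroup (Fin k))} (hA : AI A) (hB : AI B) : AI (A ∩ B) := fun v =>
  ((hA v).union (hB v)).subset fun h hh => by
    simp only [crossing, Set.mem_inter_iff, Set.mem_ofPred_eq, Set.mem_union] at *
    tauto

open Classical in
lemma Bd_of_card_lt {ε : ℝ} (hε : 0 ≤ ε) (hε' : ε ≤ 1 / 3) (hk : 2 ≤ k) {n : ℕ}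
    {A : Set (FreeGroup (Fin k))} (hA : AI A) (hinf : A.Infinite)
    (hcoinf : Aᶜ.Infinite) (hlev : Level (n + 1) A) {u : FreeGroup (Fin k)} (hu : wlen u = n)
    {x : Letter k} (hx : u.toWord.getLast? = some x) {T : Finset (FreeGroup (Fin k))}
    (hT : ∀ w, wlen w = n → w ∉ insert u T → ConstOn A w)
    (ih : ∀ B : Set (FreeGroup (Fin k)), AI B → B.Infinite → Bᶜ.Infinite → Level (n + 1) B →
      (∀ w, wlen w = n → w ∉ T → ConstOn B w) → Bd ε B)
    (hlt : (Finset.univ.filter fun s => s ≠ linv x ∧ u * letter s ∈ A).card <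
      (Finset.univ.filter fun s => s ≠ linv x ∧ u * letter s ∉ A).card) : Bd ε A := by
  have hword : ∀ s, s ≠ linv x → (u * letter s).toWord = u.toWord ++ [s] := fun s hs => by
    rw [toWord_mul_of_getLast hx (by rwa [letter_mem_cyl]), toWord_letter]
  have hcyl : ∀ s, s ≠ linv x → ∀ h ∈ cyl s, (u * h ∈ A ↔ u * letter s ∈ A) := by
    intro s hs h hh
    refine hlev (u * letter s) ?_ _ ?_
    · rw [wlen, hword s hs, List.length_append, ← hu]; rfl
    · have h1 : h ∉ cyl (linv x) := fun h2 => hs (cyl_inj hh h2)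
      obtain ⟨r, hr⟩ := List.head?_eq_some_iff.1 hh
      refine ⟨r, ?_⟩
      rw [hword s hs, toWord_mul_of_getLast hx h1, hr]; simp
  have hmem : ∀ h, h ∈ tr u⁻¹ A ↔ u * h ∈ A := fun h => by rw [mem_tr, inv_inv]
  suffices h : Bd ε (tr u⁻¹ A) by simpa [tr_tr, tr_one] using h.tr u
  have hD : tr u⁻¹ A ∩ cyl (linv x) = tr u⁻¹ (A \ desc u) := by
    ext h
    rw [Set.mem_inter_iff, mem_tr, mem_tr, Set.mem_sdiff, inv_inv, mem_desc_iff hx]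
    simp
  have hcards : (Finset.univ.filter fun s => s ≠ linv x ∧ u * letter s ∈ A).card +
      (Finset.univ.filter fun s => s ≠ linv x ∧ u * letter s ∉ A).card + 1 = 2 * k := by
    rw [← Finset.filter_filter, ← Finset.filter_filter, Finset.card_filter_add_card_filter_not,
      ← card_letter, Finset.filter_ne', Finset.card_erase_of_mem (Finset.mem_univ _),
      Finset.card_univ, card_letter]
    omega
  refine Bd_of_inter hε hε' (hA.tr _) (tr_infinite _ hinf) (t := linv x)
    (I := Finset.univ.filter fun s => s ≠ linv x ∧ u * letter s ∈ A)
    (J := Finset.univ.filter fun s => s ≠ linv x ∧ u * letter s ∉ A)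
    ?_ ?_ (by simp) ?_ (by simp) ?_ hlt (by omega) ?_
  · intro s hs h hh
    simp only [Finset.mem_filter, Finset.mem_univ, true_and] at hs
    rw [hmem, hcyl s hs.1 h hh]; exact hs.2
  · intro s hs
    simp only [Finset.mem_filter, Finset.mem_univ, true_and] at hs
    rw [Set.disjoint_left]
    intro h hh
    rw [hmem, hcyl s hs.1 h hh]; exact hs.2
  · intro s hs
    simp only [Finset.mem_filter, Finset.mem_univ, true_and, hs, ne_eq, not_false_iff]
    tauto
  · rw [Finset.disjoint_left]; intro s; simp; tauto
  · intro hi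
    rw [hD] at hi ⊢
    have hi' : (A \ desc u).Infinite := by simpa [tr_tr, tr_one] using tr_infinite u hi
    refine (ih _ ?_ hi' (hcoinf.mono (Set.compl_subset_compl.2 Set.sdiff_subset)) ?_ ?_).tr _
    · have := ((hA.tr u⁻¹).inter (AI_cyl (linv x))).tr u
      rw [hD, tr_tr] at this
      simpa [tr_one] using this
    · exact fun w hw => (hlev w hw).diff (by omega)
    · intro w hw hwT
      by_cases hwu : w = u
      · rw [hwu]; exact constOn_diff_self A u
      · exact (hT w hw (by simp [hwu, hwT])).diff (by omega)

lemma Bd_of_level {ε : ℝ} (hε : 0 ≤ ε) (hε' : ε ≤ 1 / 3) (hk : 2 ≤ k) (n : ℕ) :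
    ∀ A : Set (FreeGroup (Fin k)), AI A → A.Infinite → Aᶜ.Infinite → Level n A → Bd ε A := by
  classical
  induction n with
  | zero =>
    intro A hA hinf hcoinf hlev
    have h0 := hlev 1 (by simp [wlen])
    have hall : ∀ g, g ∈ A ↔ (1 : FreeGroup (Fin k)) ∈ A := fun g => h0 g (by simp [desc])
    by_cases h : (1 : FreeGroup (Fin k)) ∈ A
    · refine absurd hcoinf ?_
      rw [Set.eq_univ_of_forall fun g => (hall g).2 h]; simp
    · refine absurd hinf ?_
      rw [Set.eq_empty_of_forall_notMem fun g hg => h ((hall g).1 hg)]; simp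
  | succ n ihn =>
    suffices H : ∀ T : Finset (FreeGroup (Fin k)), ∀ A : Set (FreeGroup (Fin k)), AI A →
        A.Infinite → Aᶜ.Infinite → Level (n + 1) A →
        (∀ w, wlen w = n → w ∉ T → ConstOn A w) → Bd ε A from fun A hA h1 h2 h3 =>
      H (finite_sphere n).toFinset A hA h1 h2 h3 fun w hw hw' => absurd (by simpa using hw) hw'
    intro T
    induction T using Finset.induction_on with
    | empty => exact fun A hA h1 h2 _ h4 => ihn A hA h1 h2 fun w hw => h4 w hw (by simp)
    | insert u T _ ih =>
      intro A hA h1 h2 h3 h4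
      by_cases hu : wlen u = n
      swap
      · refine ih A hA h1 h2 h3 fun w hw hwT => h4 w hw ?_
        rw [Finset.mem_insert, not_or]
        exact ⟨fun e => hu (e ▸ hw), hwT⟩
      cases hx : u.toWord.getLast? with
      | none =>
        have hu1 : u = 1 := toWord_eq_nil_iff.1 (by simpa using hx)
        have hn : n = 0 := by rw [← hu, hu1]; simp [wlen]
        subst hn
        have hAU : AEq (cylU (Finset.univ.filter fun s => letter s ∈ A)) A := by
          refine (Set.finite_singleton (1 : FreeGroup (Fin k))).subset fun h hh => ?_
          by_contra hne
          obtain ⟨s, hs⟩ := exists_mem_cyl hne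
          obtain ⟨r, hr⟩ := List.head?_eq_some_iff.1 hs
          have h5 := h3 (letter s) (by simp [wlen, toWord_letter]) h
            ⟨r, by rw [hr, toWord_letter]; rfl⟩
          refine hh ⟨?_, fun h6 => ⟨s, by simpa using h5.1 h6, hs⟩⟩
          rintro ⟨t, ht, h6⟩
          obtain rfl := cyl_inj hs h6
          exact h5.2 (by simpa using ht)
        refine (Bd_cylU hε hε' ?_ ?_).of_aeq hA hAU
        · rw [Finset.card_pos, Finset.nonempty_iff_ne_empty]
          intro h0
          rw [h0] at hAU
          exact hAU.symm.infinite h1 (by simp [cylU])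
        · rw [← card_letter, ← Finset.card_univ]
          refine lt_of_le_of_ne (Finset.card_le_univ _) fun h0 => ?_
          rw [Finset.card_univ, Finset.card_eq_iff_eq_univ] at h0
          rw [h0] at hAU
          refine hAU.compl.symm.infinite h2 ?_
          rw [← Set.not_infinite]
          intro hinf
          refine (aeq_compl_cylU _).infinite hinf ?_
          simp [cylU]
      | some x =>
        have hne : (Finset.univ.filter fun s => s ≠ linv x ∧ u * letter s ∈ A).card ≠
            (Finset.univ.filter fun s => s ≠ linv x ∧ u * letter s ∉ A).card := by
          have : (Finset.univ.filter fun s => s ≠ linv x ∧ u * letter s ∈ A).card +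
              (Finset.univ.filter fun s => s ≠ linv x ∧ u * letter s ∉ A).card + 1 = 2 * k := by
            rw [← Finset.filter_filter, ← Finset.filter_filter,
              Finset.card_filter_add_card_filter_not, ← card_letter, Finset.filter_ne',
              Finset.card_erase_of_mem (Finset.mem_univ _), Finset.card_univ, card_letter]
            omega
          omega
        rcases lt_or_gt_of_ne hne with hlt | hlt
        · exact Bd_of_card_lt hε hε' hk hA h1 h2 h3 hu hx h4 ih hlt
        · refine Bd.of_compl (Bd_of_card_lt hε hε' hk hA.compl h2 (by rwa [compl_compl])
            (fun w hw => (h3 w hw).compl) hu hx (fun w hw hw' => (h4 w hw hw').compl) ih ?_)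
          simpa using hlt

theorem AI.bd {ε : ℝ} (hε : 0 ≤ ε) (hε' : ε ≤ 1 / 3) (hk : 2 ≤ k)
    {A : Set (FreeGroup (Fin k))} (hA : AI A) (hinf : A.Infinite) (hcoinf : Aᶜ.Infinite) :
    Bd ε A := by
  obtain ⟨n, hn⟩ := hA.exists_level
  exact Bd_of_level hε hε' hk n A hA hinf hcoinf hn

lemma exists_letter_ne (hk : 2 ≤ k) (a b : Letter k) : ∃ c, c ≠ a ∧ c ≠ b := by
  classical
  by_contra! h
  have h1 : (Finset.univ : Finset (Letter k)) ⊆ {a, b} := fun c _ => by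
    simp only [Finset.mem_insert, Finset.mem_singleton]
    by_cases hc : c = a
    · exact Or.inl hc
    · exact Or.inr (h c hc)
  have h2 := (Finset.card_le_card h1).trans (Finset.card_insert_le _ _)
  rw [Finset.card_univ, card_letter, Finset.card_singleton] at h2
  omega

lemma cyl_infinite (s : Letter k) : (cyl s).Infinite := by
  have hred : ∀ n, IsReduced (List.replicate (n + 1) s) := by
    intro n
    induction n with
    | zero => exact IsReduced.singleton
    | succ n ih =>
      rw [List.replicate_succ]
      refine isReduced_cons.2 ⟨?_, ih⟩
      simpa [List.replicate_succ] using (linv_ne s).symm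
  refine Set.infinite_of_injective_forall_mem
    (f := fun n => FreeGroup.mk (List.replicate (n + 1) s)) (fun a b hab => ?_) fun n => ?_
  · have := congrArg (List.length ∘ FreeGroup.toWord) hab
    simp only [Function.comp, toWord_mk_of_isReduced (hred _), List.length_replicate] at this
    omega
  · rw [mem_cyl, toWord_mk_of_isReduced (hred n)]; rfl

lemma cyl_disjoint {s t : Letter k} (h : s ≠ t) : Disjoint (cyl s) (cyl t) :=
  Set.disjoint_left.2 fun _ h1 h2 => h (cyl_inj h1 h2)

lemma cyl_compl_infinite (s : Letter k) : ((cyl s)ᶜ).Infinite :=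
  (cyl_infinite (linv s)).mono (cyl_disjoint (linv_ne s)).subset_compl_right

/-- The image under an automorphism of the words starting with `s`. -/
def imCyl (θ : FreeGroup (Fin k) ≃* FreeGroup (Fin k)) (s : Letter k) :
    Set (FreeGroup (Fin k)) := {h | θ.symm h ∈ cyl s}

lemma crossing_imCyl (θ : FreeGroup (Fin k) ≃* FreeGroup (Fin k)) (s : Letter k)
    (v : FreeGroup (Fin k)) :
    crossing (imCyl θ s) v = θ.symm ⁻¹' crossing (cyl s) (θ.symm v) := by
  ext h; simp [crossing, imCyl]

lemma AI_imCyl (θ : FreeGroup (Fin k) ≃* FreeGroup (Fin k)) (s : Letter k) :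
    AI (imCyl θ s) := fun v => by
  rw [crossing_imCyl]; exact (AI_cyl s _).preimage θ.symm.injective.injOn

lemma cr_imCyl (θ : FreeGroup (Fin k) ≃* FreeGroup (Fin k)) (s : Letter k)
    (v : FreeGroup (Fin k)) : cr (imCyl θ s) v = cr (cyl s) (θ.symm v) := by
  rw [cr, crossing_imCyl]
  exact Set.ncard_preimage_of_injective_subset_range θ.symm.injective
    (by rw [θ.symm.surjective.range_eq]; exact Set.subset_univ _)

lemma preimage_infinite {S : Set (FreeGroup (Fin k))} (hS : S.Infinite)
    (θ : FreeGroup (Fin k) ≃* FreeGroup (Fin k)) : (θ ⁻¹' S).Infinite :=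
  hS.preimage (by rw [θ.surjective.range_eq]; exact Set.subset_univ _)

lemma stretch {ε : ℝ} (hε : 0 ≤ ε) (hε' : ε ≤ 1 / 3) (hk : 2 ≤ k)
    (θ : FreeGroup (Fin k) ≃* FreeGroup (Fin k)) (hθ : ∃ s, ¬ Half (imCyl θ s)) :
    ∃ C : ℝ, ∀ v, Unif ε v →
      (1 - ε + (1 - 3 * ε) / (2 * k * (2 * k - 1))) * wlen v - C ≤ wlen (θ.symm v) := by
  classical
  have hB : ∀ s, Bd ε (imCyl θ s) := fun s => AI.bd hε hε' hk (AI_imCyl θ s)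
    (preimage_infinite (cyl_infinite s) θ.symm)
    (preimage_infinite (cyl_compl_infinite s) θ.symm)
  choose C hC using hB
  refine ⟨(∑ s, C s) / 2, fun v hv => ?_⟩
  have hk' : (2 : ℝ) ≤ k := by exact_mod_cast hk
  have h1 : ∑ s, (rate ε (imCyl θ s) * tau v - C s) ≤ 2 * wlen (θ.symm v) := by
    refine (Finset.sum_le_sum fun s _ => hC s v hv).trans ?_
    have := sum_cr_cyl_le (θ.symm v)
    simp only [cr_imCyl]
    exact_mod_cast this
  have h2 : 2 * k * (2 * (2 * k - 1) * (1 - ε)) + 2 * (1 - 3 * ε) ≤ ∑ s, rate ε (imCyl θ s) := by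
    obtain ⟨s, hs⟩ := hθ
    unfold rate
    rw [Finset.sum_add_distrib, Finset.sum_const, Finset.card_univ, card_letter, nsmul_eq_mul]
    push_cast
    refine add_le_add le_rfl ?_
    refine le_trans ?_ (Finset.single_le_sum (f := fun s => if Half (imCyl θ s) then (0 : ℝ) else
      2 * (1 - 3 * ε)) (fun t _ => ?_) (Finset.mem_univ s))
    · simp [hs]
    · split_ifs <;> linarith
  rw [Finset.sum_sub_distrib, ← Finset.sum_mul] at h1
  have h3 := mul_le_mul_of_nonneg_right h2 (tau_nonneg v)
  have h4 : (wlen v : ℝ) = 2 * k * (2 * k - 1) * tau v := by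
    unfold tau
    have : (2 * k - 1 : ℝ) ≠ 0 := by linarith
    field_simp
  have h5 : (1 - ε + (1 - 3 * ε) / (2 * k * (2 * k - 1))) * wlen v =
      (2 * k * (2 * k - 1) * (1 - ε) + (1 - 3 * ε)) * tau v := by
    rw [h4]
    have : (2 * k - 1 : ℝ) ≠ 0 := by linarith
    field_simp
  rw [h5]
  linarith

/-- The composition of a relabelling of the letters with an inner automorphism. -/
def Simple (θ : FreeGroup (Fin k) ≃* FreeGroup (Fin k)) : Prop :=
  ∃ g, ∃ π : Equiv.Perm (Letter k), ∀ s, θ (letter s) = g * letter (π s) * g⁻¹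

lemma Simple.symm {θ : FreeGroup (Fin k) ≃* FreeGroup (Fin k)} (h : Simple θ) :
    Simple θ.symm := by
  obtain ⟨g, π, hg⟩ := h
  refine ⟨(θ.symm g)⁻¹, π.symm, fun s => ?_⟩
  apply θ.injective
  simp [hg, mul_assoc]

lemma getLast_mul_letter {g : FreeGroup (Fin k)} {t : Letter k} (h : g⁻¹ ∉ cyl t) :
    (g * letter t).toWord.getLast? = some t := by
  have h1 : (letter (linv t) * g⁻¹).toWord = linv t :: g⁻¹.toWord :=
    toWord_letter_mul (by rwa [linv_linv])
  have h2 : g * letter t = (letter (linv t) * g⁻¹)⁻¹ := by simp [letter_linv]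
  rw [h2, toWord_inv, h1, invRev_cons']
  simp

lemma tr_cyl_eq_desc {g : FreeGroup (Fin k)} {t : Letter k} (h : g⁻¹ ∉ cyl t) :
    tr g (cyl t) = desc (g * letter t) := by
  ext y
  rw [mem_desc_iff (getLast_mul_letter h), mul_inv_rev, mul_assoc, letter_inv_mul_mem_cyl, mem_tr,
    not_not]

lemma tr_cyl_eq_compl_desc {g : FreeGroup (Fin k)} {t : Letter k} (h : g⁻¹ ∈ cyl t) :
    tr g (cyl t) = (desc g)ᶜ := by
  have h1 : (tr g (cyl t))ᶜ = tr (g * letter t) (cyl (linv t)) := by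
    rw [← tr_compl, compl_cyl, tr_tr]
  have h2 : (g * letter t)⁻¹ ∉ cyl (linv t) := by
    rw [mul_inv_rev, letter_inv_mul_mem_cyl]; exact not_not.2 h
  rw [← compl_compl (tr g (cyl t)), h1, tr_cyl_eq_desc h2, letter_linv, mul_inv_cancel_right]

lemma desc_letter (t : Letter k) : desc (letter t) = cyl t := by
  ext h
  rw [mem_cyl, List.head?_eq_some_iff, desc, Set.mem_ofPred_eq, toWord_letter]
  exact ⟨fun ⟨r, hr⟩ => ⟨r, hr.symm⟩, fun ⟨r, hr⟩ => ⟨r, hr.symm⟩⟩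

lemma desc_subset_cyl {u : FreeGroup (Fin k)} {t : Letter k} (h : u ∈ cyl t) :
    desc u ⊆ cyl t := by
  rintro g ⟨r, hr⟩
  obtain ⟨l, hl⟩ := List.head?_eq_some_iff.1 h
  rw [mem_cyl, ← hr, hl]; rfl

lemma eq_letter_of_cyl_diff_finite (hk : 2 ≤ k) {u : FreeGroup (Fin k)} {t : Letter k}
    (hu : u ≠ 1) (h : (cyl t \ desc u).Finite) : u = letter t := by
  obtain ⟨s, hs⟩ := exists_mem_cyl hu
  have hst : s = t := by
    by_contra hst
    refine cyl_infinite t (h.subset fun g hg => ⟨hg, fun h1 => ?_⟩)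
    exact hst (cyl_inj (desc_subset_cyl hs h1) hg)
  subst hst
  obtain ⟨r, hr⟩ := List.head?_eq_some_iff.1 hs
  cases r with
  | nil => rw [← mk_toWord (x := u), hr]; rfl
  | cons y r =>
    exfalso
    obtain ⟨z, hz1, hz2⟩ := exists_letter_ne hk y (linv s)
    have hinf := tr_infinite (letter s) (cyl_infinite z)
    refine hinf (h.subset fun g hg => ?_)
    have hg' : (letter s)⁻¹ * g ∉ cyl (linv s) := fun h1 => hz2 (cyl_inj hg h1)
    obtain ⟨r', hr'⟩ := List.head?_eq_some_iff.1 hg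
    have hw := toWord_letter_mul hg'
    rw [mul_inv_cancel_left, hr'] at hw
    refine ⟨by rw [mem_cyl, hw]; rfl, ?_⟩
    rintro ⟨q, hq⟩
    rw [hw, hr] at hq
    simp only [List.cons_append, List.cons.injEq, true_and] at hq
    exact hz1 hq.1.symm

lemma AEq.finite_diff {α : Type*} {A B : Set α} (h : AEq A B) : (A \ B).Finite :=
  Set.Finite.subset h fun x hx => by simp only [Set.mem_ofPred_eq, Set.mem_sdiff] at *; tauto

lemma eq_one_of_aeq_tr_cyl (hk : 2 ≤ k) {g : FreeGroup (Fin k)} {t t' : Letter k}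
    (h : AEq (tr g (cyl t)) (cyl t')) : g = 1 := by
  by_cases hg : g⁻¹ ∈ cyl t
  · exfalso
    rw [tr_cyl_eq_compl_desc hg] at h
    have hg1 : g ≠ 1 := by rintro rfl; exact one_notMem_cyl t (by simpa using hg)
    obtain ⟨s, hs⟩ := exists_mem_cyl hg1
    obtain ⟨z, hz1, hz2⟩ := exists_letter_ne hk t' s
    refine cyl_infinite z (h.finite_diff.subset fun x hx => ⟨fun h1 => ?_, fun h1 => ?_⟩)
    · exact hz2 (cyl_inj hx (desc_subset_cyl hs h1))
    · exact hz1 (cyl_inj hx h1)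
  · have hl := getLast_mul_letter hg
    rw [tr_cyl_eq_desc hg] at h
    have hne : g * letter t ≠ 1 := fun e => by rw [e] at hl; simp at hl
    have h1 := eq_letter_of_cyl_diff_finite hk hne h.symm.finite_diff
    rw [h1, toWord_letter] at hl
    obtain rfl : t' = t := by simpa using hl
    simpa using h1

lemma simple_of_aeq_cyl (hk : 2 ≤ k) (θ : FreeGroup (Fin k) ≃* FreeGroup (Fin k))
    {g : FreeGroup (Fin k)} {π : Equiv.Perm (Letter k)}
    (h : ∀ s, AEq (tr g⁻¹ (imCyl θ s)) (cyl (π s))) : Simple θ := by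
  set θ' : FreeGroup (Fin k) ≃* FreeGroup (Fin k) := θ.trans (MulAut.conj g⁻¹) with hθ'
  have hsymm : ∀ x, θ'.symm x = θ.symm (g * x * g⁻¹) := fun x => by
    rw [MulEquiv.symm_apply_eq]; simp [hθ', mul_assoc]
  have himg : ∀ s, AEq (imCyl θ' s) (cyl (π s)) := fun s => by
    refine AEq.trans ?_ (h s)
    refine (((AI_imCyl θ s).tr g⁻¹) g⁻¹).subset fun x hx => ?_
    simp only [crossing, imCyl, mem_tr, hsymm, Set.mem_ofPred_eq, inv_inv] at *
    rw [mul_assoc] at hx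
    tauto
  have key : ∀ s, θ' (letter s) = letter (π s) := by
    intro s
    have h1 := (himg s).compl
    rw [compl_cyl] at h1
    have h2 : (imCyl θ' s)ᶜ = tr (θ' (letter s)) (imCyl θ' (linv s)) := by
      ext x
      have : x ∈ (imCyl θ' s)ᶜ ↔ θ'.symm x ∈ (cyl s)ᶜ := Iff.rfl
      rw [this, compl_cyl, mem_tr, mem_tr]
      simp [imCyl]
    rw [h2] at h1
    have h3 := (((himg (linv s)).tr (θ' (letter s))).symm.trans h1).tr (letter (π s))⁻¹
    rw [tr_tr, tr_tr, inv_mul_cancel, tr_one] at h3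
    exact (inv_mul_eq_one.1 (eq_one_of_aeq_tr_cyl hk h3)).symm
  refine ⟨g, π, fun s => ?_⟩
  rw [← key s]
  simp [hθ', mul_assoc]

lemma simple_of_half (hk : 2 ≤ k) (θ : FreeGroup (Fin k) ≃* FreeGroup (Fin k))
    (h : ∀ s, Half (imCyl θ s)) : Simple θ := by
  choose g t hgt using h
  let s₀ : Letter k := (⟨0, by omega⟩, true)
  set A : Letter k → Set (FreeGroup (Fin k)) := fun s => tr (g s₀)⁻¹ (imCyl θ s) with hA
  set w : Letter k → FreeGroup (Fin k) := fun s => (g s₀)⁻¹ * g s with hw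
  have hAK : ∀ s, AEq (A s) (tr (w s) (cyl (t s))) := fun s => by
    have := (hgt s).tr (g s₀)⁻¹
    rwa [tr_tr] at this
  have hinf : ∀ s, (A s).Infinite := fun s =>
    tr_infinite _ (preimage_infinite (cyl_infinite s) θ.symm)
  have hdisj : ∀ s s', s ≠ s' → ∀ x ∈ A s, x ∉ A s' := fun s s' hs x h1 h2 => hs (cyl_inj h1 h2)
  have h0 : AEq (A s₀) (cyl (t s₀)) := by simpa [hw, tr_one] using hAK s₀
  have hone : ∀ s, (w s)⁻¹ ∉ cyl (t s) := by
    intro s hs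
    have hK := hAK s
    rw [tr_cyl_eq_compl_desc hs] at hK
    have hw1 : w s ≠ 1 := by
      intro e; rw [e, inv_one] at hs; exact one_notMem_cyl _ hs
    have hss : s ≠ s₀ := by
      rintro rfl; exact hw1 (by simp [hw])
    have h1 : (cyl (t s₀) \ desc (w s)).Finite := by
      refine (Set.Finite.union h0 hK).subset fun x hx => ?_
      have := hdisj s s₀ hss x
      simp only [Set.mem_sdiff, Set.mem_union, Set.mem_ofPred_eq, Set.mem_compl_iff] at *
      tauto
    have h2 := eq_letter_of_cyl_diff_finite hk hw1 h1
    rw [h2, desc_letter] at hK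
    obtain ⟨z, hz1, hz2⟩ := exists_letter_ne hk s s₀
    refine hinf z ((Set.Finite.union h0 hK).subset fun x hx => ?_)
    have h3 := hdisj z s hz1 x hx
    have h4 := hdisj z s₀ hz2 x hx
    simp only [Set.mem_union, Set.mem_ofPred_eq, Set.mem_compl_iff] at *
    tauto
  set u : Letter k → FreeGroup (Fin k) := fun s => w s * letter (t s) with hu
  have hAu : ∀ s, AEq (A s) (desc (u s)) := fun s => by
    have := hAK s
    rwa [tr_cyl_eq_desc (hone s)] at this
  have hu1 : ∀ s, u s ≠ 1 := fun s e => by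
    have := getLast_mul_letter (hone s)
    rw [show w s * letter (t s) = 1 from e] at this; simp at this
  choose f hf using fun s => exists_mem_cyl (hu1 s)
  have hcover : ∀ z, ((cyl z) \ ⋃ s ∈ {s | f s = z}, desc (u s)).Finite := by
    intro z
    refine ((Set.finite_iUnion fun s => hAu s).union
      (Set.finite_singleton (g s₀)⁻¹)).subset fun x hx => ?_
    by_cases hx1 : x = (g s₀)⁻¹
    · exact Or.inr hx1
    left
    have hne : θ.symm (g s₀ * x) ≠ 1 := fun e => hx1 (by
      rw [map_eq_one_iff _ θ.symm.injective] at e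
      exact eq_inv_of_mul_eq_one_right e)
    obtain ⟨s, hs⟩ := exists_mem_cyl hne
    have hsA : x ∈ A s := by simpa [hA, mem_tr, imCyl] using hs
    refine Set.mem_iUnion.2 ⟨s, fun hiff => hx.2 ?_⟩
    have h1 := hiff.1 hsA
    exact Set.mem_biUnion (cyl_inj (desc_subset_cyl (hf s) h1) hx.1) h1
  have hsurj : Function.Surjective f := by
    intro z
    by_contra! hcon
    refine cyl_infinite z ((hcover z).subset fun x hx => ⟨hx, ?_⟩)
    simp [hcon]
  have hbij : Function.Bijective f := Finite.injective_iff_bijective.1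
    (Finite.injective_iff_surjective.2 hsurj)
  refine simple_of_aeq_cyl hk θ (g := g s₀) (π := Equiv.ofBijective f hbij) fun s => ?_
  have h1 : u s = letter (f s) := by
    refine eq_letter_of_cyl_diff_finite hk (hu1 s) ((hcover (f s)).subset fun x hx => ⟨hx.1, ?_⟩)
    rintro hx'
    obtain ⟨s', hs', hx''⟩ := Set.mem_iUnion₂.1 hx'
    obtain rfl := hbij.1 hs'
    exact hx.2 hx''
  have h2 := hAu s
  rw [h1, desc_letter] at h2
  exact h2

/-- An automorphism is simple or its inverse stretches all words with uniform two-letter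
frequencies. -/
theorem simple_or_stretch {ε : ℝ} (hε : 0 ≤ ε) (hε' : ε ≤ 1 / 3) (hk : 2 ≤ k)
    (θ : FreeGroup (Fin k) ≃* FreeGroup (Fin k)) : Simple θ ∨ ∃ C : ℝ, ∀ v, Unif ε v →
      (1 - ε + (1 - 3 * ε) / (2 * k * (2 * k - 1))) * wlen v - C ≤ wlen (θ.symm v) := by
  by_cases h : ∀ s, Half (imCyl θ s)
  · exact Or.inl (simple_of_half hk θ h)
  · push Not at h
    exact Or.inr (stretch hε hε' hk θ h)

lemma cnt_le_length (a b : Letter k) (l : List (Letter k)) : cnt a b l ≤ l.length := by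
  induction l with
  | nil => simp [cnt]
  | cons x l ih => simp only [cnt, List.length_cons]; split_ifs <;> omega

lemma cnt_cons_cons (a b x y : Letter k) (l : List (Letter k)) :
    cnt a b (x :: y :: l) = cnt a b (y :: l) + if x = a ∧ y = b then 1 else 0 := by
  rw [cnt]
  simp

lemma cnt_append (a b : Letter k) (l r : List (Letter k)) :
    cnt a b l + cnt a b r ≤ cnt a b (l ++ r) ∧
      cnt a b (l ++ r) ≤ cnt a b l + cnt a b r + 1 := by
  induction l with
  | nil => simp [cnt]
  | cons x l ih =>
    cases l with
    | nil => simp only [cnt, List.cons_append, List.nil_append]; split_ifs <;> simp_all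
    | cons y l => rw [List.cons_append] at ih; simp only [cnt_cons_cons, List.cons_append]; omega

lemma cnt_append_singleton (a b : Letter k) (l : List (Letter k)) (x : Letter k) :
    cnt a b (l ++ [x]) = cnt a b l + if l.getLast? = some a ∧ x = b then 1 else 0 := by
  induction l with
  | nil => simp [cnt]
  | cons y l ih =>
    cases l with
    | nil => simp [cnt]
    | cons z l =>
      rw [List.cons_append] at ih
      rw [List.cons_append, List.cons_append, cnt_cons_cons, cnt_cons_cons, ih,
        List.getLast?_cons_cons]
      omega

lemma head?_invRev_eq (l : List (Letter k)) (b : Letter k) :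
    (invRev l).getLast? = some (linv b) ↔ l.head? = some b := by
  cases l with
  | nil => simp [invRev]
  | cons x l => rw [invRev_cons']; simp [linv_injective.eq_iff]

lemma cnt_invRev (a b : Letter k) (l : List (Letter k)) :
    cnt a b (invRev l) = cnt (linv b) (linv a) l := by
  induction l with
  | nil => simp [cnt, invRev]
  | cons x l ih =>
    rw [invRev_cons', cnt_append_singleton, cnt, ih]
    have h1 : (invRev l).getLast? = some a ↔ l.head? = some (linv a) := by
      rw [← head?_invRev_eq, linv_linv]
    simp only [h1, linv_eq_iff]
    congr 1
    simp only [and_comm]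

/-- The generators and their inverses. -/
def gens (w : Fin p → FreeGroup (Fin k)) (x : Letter p) : FreeGroup (Fin k) :=
  if x.2 then w x.1 else (w x.1)⁻¹

lemma gens_linv (w : Fin p → FreeGroup (Fin k)) (x : Letter p) :
    gens w (linv x) = (gens w x)⁻¹ := by
  obtain ⟨i, e⟩ := x
  cases e <;> simp [gens, linv]

lemma lift_mk_cons (w : Fin p → FreeGroup (Fin k)) (x : Letter p) (L : List (Letter p)) :
    FreeGroup.lift w (FreeGroup.mk (x :: L)) = gens w x * FreeGroup.lift w (FreeGroup.mk L) := by
  obtain ⟨i, e⟩ := x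
  cases e <;> simp [gens]

/-- The genericity conditions on a tuple of words: they are long, have uniform two-letter
frequencies, and long subwords do not repeat, even up to relabelling. -/
structure Gen (w : Fin p → FreeGroup (Fin k)) (n m : ℕ) (δ : ℝ) : Prop where
  le_wlen : ∀ i, n ≤ wlen (w i) + m
  freq : ∀ i a b, b ≠ linv a → |(cnt a b (w i).toWord : ℝ) - tau (w i)| ≤ δ
  coinc : ∀ (x y : Letter p) (ρ : Equiv.Perm (Letter k)) (A u B A' B' : List (Letter k)),
    (gens w x).toWord = A ++ u ++ B → (gens w y).toWord = A' ++ u.map ρ ++ B' →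
    m ≤ u.length → ρ = 1 ∧ x = y ∧ A.length = A'.length

namespace Gen

variable {w : Fin p → FreeGroup (Fin k)} {n m : ℕ} {δ : ℝ}

lemma le_wlen_gens (hw : Gen w n m δ) (x : Letter p) : n ≤ wlen (gens w x) + m := by
  obtain ⟨i, e⟩ := x
  cases e <;> simp [gens, wlen_inv, hw.le_wlen]

lemma freq_gens (hw : Gen w n m δ) (x : Letter p) (a b : Letter k) (hab : b ≠ linv a) :
    |(cnt a b (gens w x).toWord : ℝ) - tau (gens w x)| ≤ δ := by
  obtain ⟨i, e⟩ := x
  cases e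
  · have := hw.freq i (linv b) (linv a) (by simpa using fun h => hab h.symm)
    simpa [gens, toWord_inv, cnt_invRev, tau, wlen_inv] using this
  · simpa [gens] using hw.freq i a b hab

/-- Small cancellation. -/
lemma cancel (hw : Gen w n m δ) (hm : 7 * m ≤ n) {x : Letter p} {L : List (Letter p)}
    (hL : IsReduced (x :: L)) :
    ∃ A c B, (gens w x).toWord = A ++ c ∧
      (FreeGroup.lift w (FreeGroup.mk L)).toWord = invRev c ++ B ∧
      (FreeGroup.lift w (FreeGroup.mk (x :: L))).toWord = A ++ B ∧ c.length ≤ m := by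
  induction L generalizing x with
  | nil =>
    refine ⟨(gens w x).toWord, [], [], by simp, ?_, ?_, by simp⟩
    · simp [← FreeGroup.one_eq_mk]
    · rw [lift_mk_cons]; simp [← FreeGroup.one_eq_mk]
  | cons y L ih =>
    obtain ⟨A, c, B, h1, h2, h3⟩ := exists_cancel (gens w x)
      (FreeGroup.lift w (FreeGroup.mk (y :: L)))
    refine ⟨A, c, B, h1, h2, by rw [lift_mk_cons]; exact h3, ?_⟩
    by_contra! hc
    obtain ⟨A', c', B', h1', -, h3', hc'⟩ := ih (isReduced_cons.1 hL).2
    have hlen := hw.le_wlen_gens y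
    rw [wlen, h1', List.length_append] at hlen
    obtain ⟨c₁, c₂, rfl, hc₂⟩ : ∃ c₁ c₂, c = c₁ ++ c₂ ∧ c₂.length = m :=
      ⟨c.take (c.length - m), c.drop (c.length - m), by simp, by simp; omega⟩
    rw [h3', invRev_append, List.append_assoc] at h2
    have hpre : invRev c₂ <+: A' := List.prefix_of_prefix_length_le
      ⟨_, h2.symm⟩ (List.prefix_append _ _) (by rw [invRev_length]; omega)
    obtain ⟨D, hD⟩ := hpre
    have hx : (gens w (linv x)).toWord = [] ++ invRev c₂ ++ (invRev c₁ ++ invRev A) := by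
      rw [gens_linv, toWord_inv, h1]; simp [invRev_append]
    have hy : (gens w y).toWord = [] ++ (invRev c₂).map (1 : Equiv.Perm (Letter k)) ++
        (D ++ c') := by
      rw [h1', ← hD]; simp
    have := (hw.coinc _ _ _ _ _ _ _ _ hx hy (by rw [invRev_length]; omega)).2.1
    refine (isReduced_cons.1 hL).1 ?_
    simp [this]

lemma discrepancy (hk : 2 ≤ k) (hw : Gen w n m δ) (hm : 7 * m ≤ n) (L : List (Letter p))
    (hL : IsReduced L) :
    (L.length : ℝ) * (n - 3 * m) ≤ wlen (FreeGroup.lift w (FreeGroup.mk L)) ∧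
    ∀ a b, b ≠ linv a → |(cnt a b (FreeGroup.lift w (FreeGroup.mk L)).toWord : ℝ) -
      tau (FreeGroup.lift w (FreeGroup.mk L))| ≤ L.length * (δ + 4 * m + 3) := by
  induction L with
  | nil => simp [← FreeGroup.one_eq_mk, wlen, tau, cnt]
  | cons x L ih =>
    obtain ⟨ih1, ih2⟩ := ih (isReduced_cons.1 hL).2
    obtain ⟨A, c, B, h1, h2, h3, hc⟩ := hw.cancel hm hL
    set h := FreeGroup.lift w (FreeGroup.mk (x :: L)) with hh
    set h' := FreeGroup.lift w (FreeGroup.mk L) with hh'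
    have e1 : wlen (gens w x) = A.length + c.length := by rw [wlen, h1, List.length_append]
    have e2 : wlen h' = c.length + B.length := by
      rw [wlen, h2, List.length_append, invRev_length]
    have e3 : wlen h = A.length + B.length := by rw [wlen, h3, List.length_append]
    have hc' : (c.length : ℝ) ≤ m := by exact_mod_cast hc
    have hn := hw.le_wlen_gens x
    have hk' : (2 : ℝ) ≤ k := by exact_mod_cast hk
    constructor
    · have : (n : ℝ) ≤ A.length + c.length + m := by exact_mod_cast e1 ▸ hn
      rw [e2] at ih1
      rw [e3, List.length_cons]
      push_cast at *
      linarith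
    · intro a b hab
      have g1 := hw.freq_gens x a b hab
      have g2 := ih2 a b hab
      obtain ⟨a1, a2⟩ := cnt_append a b A c
      obtain ⟨b1, b2⟩ := cnt_append a b (invRev c) B
      obtain ⟨d1, d2⟩ := cnt_append a b A B
      have l1 := cnt_le_length a b c
      have l2 := cnt_le_length a b (invRev c)
      rw [invRev_length] at l2
      rw [← h1] at a1 a2
      rw [← h2] at b1 b2
      rw [← h3] at d1 d2
      have ht : tau h + 2 * c.length / (2 * k * (2 * k - 1)) = tau (gens w x) + tau h' := by
        unfold tau
        rw [← add_div, ← add_div, e1, e2, e3]; push_cast; ring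
      have hden : (1 : ℝ) ≤ 2 * k * (2 * k - 1) := by nlinarith
      have ht' : 2 * (c.length : ℝ) / (2 * k * (2 * k - 1)) ≤ 2 * m :=
        (div_le_self (by positivity) hden).trans (by linarith)
      have ht0 : 0 ≤ 2 * (c.length : ℝ) / (2 * k * (2 * k - 1)) := by positivity
      have c1 : (cnt a b h.toWord : ℝ) ≤
          cnt a b (gens w x).toWord + cnt a b h'.toWord + 1 := by
        exact_mod_cast (by omega)
      have c2 : (cnt a b (gens w x).toWord : ℝ) + cnt a b h'.toWord ≤
          cnt a b h.toWord + 2 * m + 2 := by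
        exact_mod_cast (by omega)
      rw [abs_le] at *
      rw [List.length_cons]
      push_cast
      constructor <;> linarith

lemma unif (hk : 2 ≤ k) (hw : Gen w n m δ) (hm : 7 * m ≤ n) {ε : ℝ} (hε : 0 ≤ ε)
    (hδ : (δ + 4 * m + 3) * (2 * k * (2 * k - 1)) ≤ ε * (n - 3 * m))
    {h : FreeGroup (Fin k)} (hh : h ∈ Subgroup.closure (Set.range w)) : Unif ε h := by
  rw [← FreeGroup.range_lift_eq_closure] at hh
  obtain ⟨y, rfl⟩ := hh
  obtain ⟨h1, h2⟩ := hw.discrepancy hk hm y.toWord isReduced_toWord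
  rw [mk_toWord] at h1 h2
  intro a b hab
  refine (h2 a b hab).trans ?_
  have hk' : (2 : ℝ) ≤ k := by exact_mod_cast hk
  have hden : (0 : ℝ) < 2 * k * (2 * k - 1) := by nlinarith
  unfold tau
  rw [← mul_div_assoc, le_div_iff₀ hden, mul_assoc]
  calc (y.toWord.length : ℝ) * ((δ + 4 * m + 3) * (2 * k * (2 * k - 1)))
      ≤ y.toWord.length * (ε * (n - 3 * m)) := by gcongr
    _ = ε * (y.toWord.length * (n - 3 * m)) := by ring
    _ ≤ _ := by gcongr

lemma prefix_gens (hw : Gen w n m δ) (hm : 7 * m ≤ n) {x : Letter p} {L : List (Letter p)}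
    (hL : IsReduced (x :: L)) : ∃ A c B, (gens w x).toWord = A ++ c ∧
      (FreeGroup.lift w (FreeGroup.mk (x :: L))).toWord = A ++ B ∧ n ≤ A.length + 2 * m := by
  obtain ⟨A, c, B, h1, h2, h3, hc⟩ := hw.cancel hm hL
  refine ⟨A, c, B, h1, h3, ?_⟩
  have hlen := hw.le_wlen_gens x
  rw [wlen, h1, List.length_append] at hlen
  omega

/-- Half of any subword of moderate length of an element of the subgroup can be read along
one of the generators. -/
lemma exists_read (hw : Gen w n m δ) (hm : 7 * m ≤ n) (L : List (Letter p)) (hL : IsReduced L)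
    (P u S : List (Letter k)) (hu : 0 < u.length) (hum : u.length ≤ 4 * m)
    (h : (FreeGroup.lift w (FreeGroup.mk L)).toWord = P ++ u ++ S) :
    ∃ u₁ u' u₂, u = u₁ ++ u' ++ u₂ ∧ u.length ≤ 2 * u'.length ∧
      ∃ h₀ ∈ Subgroup.closure (Set.range w), ∃ x A B, (gens w x).toWord = A ++ u' ++ B ∧
        FreeGroup.mk (P ++ u₁) = h₀ * FreeGroup.mk A := by
  induction L generalizing P u S with
  | nil =>
    simp [← FreeGroup.one_eq_mk] at h
    rw [h.2.1] at hu; simp at hu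
  | cons x L ih =>
    obtain ⟨A, c, B, h1, h2, h3, hc⟩ := hw.cancel hm hL
    have hxH : gens w x ∈ Subgroup.closure (Set.range w) := by
      have : w x.1 ∈ Subgroup.closure (Set.range w) := Subgroup.subset_closure ⟨_, rfl⟩
      unfold gens; split_ifs
      · exact this
      · exact inv_mem this
    have hgx : gens w x * (FreeGroup.mk (invRev c)) = FreeGroup.mk A := by
      rw [← mk_toWord (x := gens w x), h1, mk_invRev, ← FreeGroup.mul_mk, mul_inv_cancel_right]
    rw [h3] at h
    rcases le_total A.length P.length with hAP | hAP
    · obtain ⟨P', rfl⟩ : A <+: P := List.prefix_of_prefix_length_le (List.prefix_append _ B)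
        (by rw [h, List.append_assoc]; exact List.prefix_append _ _) hAP
      rw [List.append_assoc, List.append_assoc, List.append_cancel_left_eq] at h
      obtain ⟨u₁, u', u₂, e1, e2, h₀, hh₀, y, A', B', e3, e4⟩ :=
        ih (isReduced_cons.1 hL).2 (invRev c ++ P') u S hu hum (by rw [h2, h]; simp)
      refine ⟨u₁, u', u₂, e1, e2, gens w x * h₀, mul_mem hxH hh₀, y, A', B', e3, ?_⟩
      rw [mul_assoc, ← e4, List.append_assoc (invRev c), ← FreeGroup.mul_mk (L₁ := invRev c),
        ← mul_assoc, hgx, FreeGroup.mul_mk, List.append_assoc]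
    · obtain ⟨A', rfl⟩ : P <+: A := List.prefix_of_prefix_length_le
        (by rw [h, List.append_assoc]; exact List.prefix_append _ _) (List.prefix_append _ B) hAP
      rw [List.append_assoc, List.append_assoc, List.append_cancel_left_eq] at h
      rcases le_total (u.length) (2 * A'.length) with hl | hl
      · obtain ⟨u', v, hv⟩ : ∃ u' v, u = u' ++ v ∧ u' <+: A' ∧ u.length ≤ 2 * u'.length := by
          rcases le_total u.length A'.length with h5 | h5
          · exact ⟨u, [], by simp, List.prefix_of_prefix_length_le
              (by rw [h]; exact List.prefix_append _ _) (List.prefix_append _ B) h5, by omega⟩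
          · obtain ⟨v, hv⟩ : A' <+: u := List.prefix_of_prefix_length_le (List.prefix_append _ B)
              (by rw [h]; exact List.prefix_append _ _) h5
            exact ⟨A', v, hv.symm, List.prefix_refl _, hl⟩
        obtain ⟨hv1, ⟨D, hD⟩, hv3⟩ := hv
        refine ⟨[], u', v, by simpa using hv1, hv3, 1, one_mem _, x, P, D ++ c, ?_, by simp⟩
        rw [h1, ← hD]; simp
      · have h5 : A'.length ≤ u.length := by
          by_contra! hcon
          omega
        obtain ⟨v, rfl⟩ : A' <+: u := List.prefix_of_prefix_length_le (List.prefix_append _ B)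
          (by rw [h]; exact List.prefix_append _ _) h5
        rw [List.append_assoc, List.append_cancel_left_eq] at h
        rw [List.length_append] at hl hum hu
        cases L with
        | nil =>
          exfalso
          simp [← FreeGroup.one_eq_mk, h] at h2
          rw [h2.2.1] at hl hu
          simp at hl hu
          omega
        | cons y L =>
          obtain ⟨E, c', F, f1, f2, f3⟩ := hw.prefix_gens hm (isReduced_cons.1 hL).2
          have h6 : invRev c ++ v <+: E := List.prefix_of_prefix_length_le
            (l₃ := (FreeGroup.lift w (FreeGroup.mk (y :: L))).toWord)
            (by rw [h2, h, ← List.append_assoc]; exact List.prefix_append _ _)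
            (by rw [f2]; exact List.prefix_append _ _)
            (by rw [List.length_append, invRev_length]; omega)
          obtain ⟨D, hD⟩ := h6
          refine ⟨A', v, [], by simp, by rw [List.length_append]; omega, gens w x, hxH, y,
            invRev c, D ++ c', ?_, hgx.symm⟩
          rw [f1, ← hD]; simp

end Gen

lemma finite_wlen_le (B : ℝ) : {g : FreeGroup (Fin k) | (wlen g : ℝ) ≤ B}.Finite := by
  refine (Set.finite_iUnion fun i : Fin (⌊B⌋₊ + 1) => finite_sphere (k := k) i).subset
    fun g hg => ?_
  have h1 : wlen g ≤ ⌊B⌋₊ := Nat.le_floor hg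
  exact Set.mem_iUnion.2 ⟨⟨wlen g, by omega⟩, rfl⟩

lemma exists_pow_wlen_gt {y : FreeGroup (Fin k)} (hy : y ≠ 1) (B : ℝ) :
    ∃ N : ℕ, B < wlen (y ^ N) := by
  by_contra! h
  refine Set.infinite_of_injective_forall_mem (f := fun N : ℕ => y ^ N) ?_ h (finite_wlen_le B)
  exact injective_pow_iff_not_isOfFinOrder.2 (not_isOfFinOrder_of_isMulTorsionFree hy)

/-- A conjugate contains a long piece of the conjugated word, aligned by the conjugator. -/
lemma conj_infix (g z : FreeGroup (Fin k)) (T : ℕ) (h : 2 * wlen g + T ≤ wlen z) :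
    ∃ P₁ P₂ U S₁ S₂, U.length = T ∧ (g * z * g⁻¹).toWord = P₁ ++ U ++ S₁ ∧
      z.toWord = P₂ ++ U ++ S₂ ∧ FreeGroup.mk P₁ = g * FreeGroup.mk P₂ := by
  obtain ⟨A, c, B, h1, h2, h3⟩ := exists_cancel g z
  obtain ⟨A', c', B', h4, h5, h6⟩ := exists_cancel (g * z) g⁻¹
  have l1 : A.length + c.length = wlen g := by rw [wlen, h1, List.length_append]
  have l2 : c.length + B.length = wlen z := by
    rw [wlen, h2, List.length_append, invRev_length]
  have l3 : c'.length + B'.length = wlen g := by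
    rw [← wlen_inv, wlen, h5, List.length_append, invRev_length]
  rw [h3] at h4
  obtain ⟨B₁, rfl⟩ : A <+: A' := List.prefix_of_prefix_length_le (List.prefix_append _ _)
    (by rw [h4]; exact List.prefix_append _ _) (by
      have := congrArg List.length h4
      rw [List.length_append, List.length_append] at this
      omega)
  rw [List.append_assoc, List.append_cancel_left_eq] at h4
  rw [h4, List.length_append] at l2
  refine ⟨A, invRev c, B₁.take T, B₁.drop T ++ B', B₁.drop T ++ c', ?_, ?_, ?_, ?_⟩
  · rw [List.length_take]; omega
  · rw [h6]; conv_lhs => rw [← List.take_append_drop T B₁]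
    simp only [List.append_assoc]
  · rw [h2, h4]; conv_lhs => rw [← List.take_append_drop T B₁]
    simp only [List.append_assoc]
  · rw [← mk_toWord (x := g), h1, mk_invRev, ← FreeGroup.mul_mk, mul_inv_cancel_right]

lemma letter_injective : Function.Injective (letter : Letter k → FreeGroup (Fin k)) :=
  fun a b h => by simpa [toWord_letter] using congrArg FreeGroup.toWord h

lemma isReduced_map {f : Letter k → Letter k} (hf : Function.Injective f)
    (hf' : ∀ s, f (linv s) = linv (f s)) {l : List (Letter k)} (hl : IsReduced l) :
    IsReduced (l.map f) := by
  induction l with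
  | nil => exact IsReduced.nil
  | cons x l ih =>
    obtain ⟨h1, h2⟩ := isReduced_cons.1 hl
    refine isReduced_cons.2 ⟨?_, ih h2⟩
    cases l with
    | nil => simp
    | cons y l => simpa [← hf', hf.eq_iff] using h1

lemma apply_eq_of_simple {θ : FreeGroup (Fin k) ≃* FreeGroup (Fin k)} {g : FreeGroup (Fin k)}
    {π : Equiv.Perm (Letter k)} (h : ∀ s, θ (letter s) = g * letter (π s) * g⁻¹)
    (y : FreeGroup (Fin k)) :
    ∃ z : FreeGroup (Fin k), z.toWord = y.toWord.map π ∧ θ y = g * z * g⁻¹ := by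
  have hπ : ∀ s, π (linv s) = linv (π s) := fun s => by
    apply letter_injective
    have h1 := h (linv s)
    rw [letter_linv, _root_.map_inv, h s] at h1
    rw [letter_linv]
    simpa [mul_assoc] using h1.symm
  refine ⟨FreeGroup.mk (y.toWord.map π),
    toWord_mk_of_isReduced (isReduced_map π.injective hπ isReduced_toWord), ?_⟩
  have key : ∀ l : List (Letter k), θ (FreeGroup.mk l) = g * FreeGroup.mk (l.map π) * g⁻¹ := by
    intro l
    induction l with
    | nil => simp [← FreeGroup.one_eq_mk]
    | cons x l ih => rw [List.map_cons, mk_cons, mk_cons, _root_.map_mul, ih, h]; group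
  rw [← key, mk_toWord]

namespace Gen

variable {w : Fin p → FreeGroup (Fin k)} {n m : ℕ} {δ ε : ℝ}

lemma exists_read_mem (hw : Gen w n m δ) (hm : 7 * m ≤ n) {h : FreeGroup (Fin k)}
    (hh : h ∈ Subgroup.closure (Set.range w))
    {P u S : List (Letter k)} (hu : 0 < u.length) (hum : u.length ≤ 4 * m)
    (hP : h.toWord = P ++ u ++ S) :
    ∃ u₁ u' u₂, u = u₁ ++ u' ++ u₂ ∧ u.length ≤ 2 * u'.length ∧
      ∃ h₀ ∈ Subgroup.closure (Set.range w), ∃ x A B, (gens w x).toWord = A ++ u' ++ B ∧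
        FreeGroup.mk (P ++ u₁) = h₀ * FreeGroup.mk A := by
  have hh' := hh
  rw [← FreeGroup.range_lift_eq_closure] at hh'
  obtain ⟨y, rfl⟩ := hh'
  rw [← mk_toWord (x := y)] at hP
  exact hw.exists_read hm y.toWord isReduced_toWord P u S hu hum hP

lemma eq_conj_of_simple (hw : Gen w n m δ) (hm : 7 * m ≤ n) (hm' : 0 < m)
    {α : FreeGroup (Fin k) ≃* FreeGroup (Fin k)} (hα : Simple α) {y : FreeGroup (Fin k)}
    (hy : y ≠ 1) (hyH : y ∈ Subgroup.closure (Set.range w))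
    (hαy : α y ∈ Subgroup.closure (Set.range w)) :
    ∃ h ∈ Subgroup.closure (Set.range w), ∀ g, α g = h * g * h⁻¹ := by
  obtain ⟨g, π, hg⟩ := hα
  obtain ⟨N, hN⟩ := exists_pow_wlen_gt hy ((2 * wlen g + 4 * m : ℕ) : ℝ)
  have hN' : 2 * wlen g + 4 * m < wlen (y ^ N) := by exact_mod_cast hN
  obtain ⟨z, hz, hαz⟩ := apply_eq_of_simple hg (y ^ N)
  obtain ⟨P₁, P₂, U, S₁, S₂, hU, e1, e2, e3⟩ := conj_infix g z (4 * m) (by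
    have : wlen z = wlen (y ^ N) := by simp [wlen, hz]
    omega)
  rw [← hαz] at e1
  obtain ⟨u₁, u', u₂, rfl, hu', h₀, hh₀, x, A, B, f1, f2⟩ := hw.exists_read_mem hm
    (by rw [_root_.map_pow]; exact pow_mem hαy N) (by omega) (by omega) e1
  have e4 : (y ^ N).toWord = (P₂.map π.symm ++ u₁.map π.symm) ++ u'.map π.symm ++
      (u₂.map π.symm ++ S₂.map π.symm) := by
    have : (y ^ N).toWord = z.toWord.map π.symm := by simp [hz]
    rw [this, e2]; simp
  have hlen : u'.length ≤ 4 * m := by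
    rw [← hU, List.length_append, List.length_append]; omega
  obtain ⟨v₁, v', v₂, hv, hv', h₁, hh₁, x', A', B', g1, g2⟩ := hw.exists_read_mem hm
    (pow_mem hyH N) (by rw [List.length_map]; omega) (by rw [List.length_map]; omega) e4
  rw [List.length_map] at hv'
  obtain ⟨a', a₂, rfl, ha', rfl⟩ := List.map_eq_append_iff.1 hv
  obtain ⟨a₁, a, rfl, rfl, rfl⟩ := List.map_eq_append_iff.1 ha'
  have f1' : (gens w x).toWord = (A ++ a₁) ++ a ++ (a₂ ++ B) := by rw [f1]; simp
  rw [List.length_map] at hv'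
  obtain ⟨hπ, rfl, hA⟩ := hw.coinc _ _ _ _ _ _ _ _ f1' g1 (by omega)
  have hAA : A' = A ++ a₁ := by
    rw [f1', List.append_assoc, List.append_assoc A'] at g1
    exact (List.append_inj_left g1 hA).symm
  have hπ' : ∀ s, π.symm s = s := fun s => by rw [hπ]; rfl
  have hπ'' : ∀ s, π s = s := fun s => (π.symm_apply_eq.1 (hπ' s)).symm
  have hmap : ∀ l : List (Letter k), l.map π.symm = l := fun l => by
    rw [show (π.symm : Letter k → Letter k) = id from funext hπ', List.map_id]
  rw [hmap, hmap, hmap, hAA, List.append_assoc, ← FreeGroup.mul_mk (L₁ := P₂)] at g2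
  have f2' : g * (FreeGroup.mk P₂ * FreeGroup.mk (u₁ ++ a₁)) =
      h₀ * FreeGroup.mk (A ++ a₁) := by
    rw [← mul_assoc, ← e3, FreeGroup.mul_mk, ← List.append_assoc, ← FreeGroup.mul_mk, f2,
      mul_assoc, FreeGroup.mul_mk]
  rw [g2, ← mul_assoc, mul_left_inj] at f2'
  have hgH : g ∈ Subgroup.closure (Set.range w) := by
    rw [eq_mul_inv_of_mul_eq f2']
    exact mul_mem hh₀ (inv_mem hh₁)
  refine ⟨g, hgH, fun q => ?_⟩
  obtain ⟨r, hr, hq⟩ := apply_eq_of_simple hg q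
  rw [show (π : Letter k → Letter k) = id from funext hπ'', List.map_id] at hr
  rw [hq, toWord_injective hr]

theorem autMalnormal (hk : 2 ≤ k) (hw : Gen w n m δ) (hm : 7 * m ≤ n) (hm' : 0 < m)
    (hε : 0 ≤ ε) (hε' : ε * (16 * k ^ 2) ≤ 1)
    (hδ : (δ + 4 * m + 3) * (2 * k * (2 * k - 1)) ≤ ε * (n - 3 * m)) :
    AutMalnormal (Subgroup.closure (Set.range w)) := by
  rintro α ⟨x, hx, hxH, hyH⟩
  obtain ⟨y, rfl⟩ : ∃ y, α y = x := ⟨α.symm x, by simp⟩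
  rw [MulEquiv.symm_apply_apply] at hyH
  have hy : y ≠ 1 := by rintro rfl; simp at hx
  suffices hs : Simple α from hw.eq_conj_of_simple hm hm' hs hy hyH hxH
  by_contra hns
  have hk' : (2 : ℝ) ≤ k := by exact_mod_cast hk
  have hε3 : ε ≤ 1 / 3 := by nlinarith
  have hns' : ¬ Simple α.symm := fun h => hns (by simpa using h.symm)
  obtain ⟨C, hC⟩ := (simple_or_stretch hε hε3 hk α).resolve_left hns
  obtain ⟨C', hC'⟩ := (simple_or_stretch hε hε3 hk α.symm).resolve_left hns'
  set c := (1 - ε + (1 - 3 * ε) / (2 * k * (2 * k - 1)) : ℝ) with hc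
  have hden : (0 : ℝ) < 2 * k * (2 * k - 1) := by nlinarith
  have hc1 : 1 < c := by
    have : ε < (1 - 3 * ε) / (2 * k * (2 * k - 1)) := by
      rw [lt_div_iff₀ hden]; nlinarith
    linarith
  obtain ⟨N, hN⟩ := exists_pow_wlen_gt hy ((C + C') / (c - 1))
  have h1 := hC (α y ^ N) (hw.unif hk hm hε hδ (pow_mem hxH N))
  have h2 := hC' (y ^ N) (hw.unif hk hm hε hδ (pow_mem hyH N))
  rw [_root_.map_pow, MulEquiv.symm_apply_apply] at h1
  rw [_root_.map_pow, MulEquiv.symm_symm] at h2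
  rw [div_lt_iff₀ (by linarith)] at hN
  have h3 : (0 : ℝ) ≤ wlen (α y ^ N) := Nat.cast_nonneg _
  nlinarith

end Gen

lemma isReduced_concat {w : List (Letter k)} {b : Letter k} :
    IsReduced (w ++ [b]) ↔ IsReduced w ∧ w.getLast? ≠ some (linv b) := by
  unfold FreeGroup.IsReduced
  rw [List.isChain_append]
  simp only [List.isChain_singleton, List.head?_cons, Option.mem_def, Option.some.injEq,
    forall_eq', true_and]
  refine and_congr_right fun _ => ?_
  cases w.getLast? with
  | none => simp
  | some a =>
    obtain ⟨i, e⟩ := a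
    obtain ⟨j, e'⟩ := b
    cases e <;> cases e' <;> simp [linv]

/-- The letters that can follow a reduced word. -/
def next (w : List (Letter k)) : Finset (Letter k) :=
  Finset.univ.filter fun b => w.getLast? ≠ some (linv b)

/-- The reduced words of a given length. -/
def RW (k : ℕ) : ℕ → Finset (List (Letter k))
  | 0 => {[]}
  | n + 1 => (RW k n).biUnion fun w => (next w).image fun b => w ++ [b]

lemma mem_RW {n : ℕ} {w : List (Letter k)} : w ∈ RW k n ↔ w.length = n ∧ IsReduced w := by
  induction n generalizing w with
  | zero =>
    simp only [RW, Finset.mem_singleton, List.length_eq_zero_iff]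
    exact ⟨fun h => ⟨h, h ▸ IsReduced.nil⟩, fun h => h.1⟩
  | succ n ih =>
    simp only [RW, Finset.mem_biUnion, Finset.mem_image, next, Finset.mem_filter, Finset.mem_univ,
      true_and]
    constructor
    · rintro ⟨v, hv, b, hb, rfl⟩
      obtain ⟨h1, h2⟩ := ih.1 hv
      exact ⟨by simp [h1], isReduced_concat.2 ⟨h2, hb⟩⟩
    · rintro ⟨h1, h2⟩
      rcases List.eq_nil_or_concat w with rfl | ⟨v, b, rfl⟩
      · simp at h1
      · rw [List.concat_eq_append] at *
        obtain ⟨h3, h4⟩ := isReduced_concat.1 h2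
        exact ⟨v, ih.2 ⟨by simpa using h1, h3⟩, b, h4, rfl⟩

lemma sum_RW_succ (f : List (Letter k) → ℝ) (n : ℕ) :
    ∑ v ∈ RW k (n + 1), f v = ∑ w ∈ RW k n, ∑ b ∈ next w, f (w ++ [b]) := by
  rw [RW, Finset.sum_biUnion]
  · refine Finset.sum_congr rfl fun w _ => Finset.sum_image fun a _ b _ h => ?_
    simpa using h
  · intro v _ w _ hvw
    rw [Function.onFun, Finset.disjoint_left]
    rintro _ h1 h2
    obtain ⟨a, _, rfl⟩ := Finset.mem_image.1 h1
    obtain ⟨b, _, h⟩ := Finset.mem_image.1 h2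
    exact hvw (List.append_inj_left' h rfl).symm

lemma card_next (w : List (Letter k)) :
    (next w).card = if w = [] then 2 * k else 2 * k - 1 := by
  rcases List.eq_nil_or_concat w with rfl | ⟨v, a, rfl⟩
  · simp [next, mul_comm]
  · rw [List.concat_eq_append]
    have : next (v ++ [a]) = Finset.univ.erase (linv a) := by
      ext b
      simp only [next, List.getLast?_append, List.getLast?_singleton, Option.some_or, ne_eq,
        Option.some.injEq, Finset.mem_filter, Finset.mem_univ, true_and, Finset.mem_erase, and_true]
      rw [← linv_eq_iff, eq_comm]
    rw [this, Finset.card_erase_of_mem (Finset.mem_univ _), Finset.card_univ, card_letter]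
    simp

lemma card_RW_succ (n : ℕ) :
    (RW k (n + 1)).card = (if n = 0 then 2 * k else 2 * k - 1) * (RW k n).card := by
  have h := sum_RW_succ (k := k) (fun _ => 1) n
  have h2 : ∀ w ∈ RW k n, (∑ b ∈ next w, (1 : ℝ)) = (if n = 0 then 2 * k else 2 * k - 1 : ℕ) := by
    intro w hw
    rw [Finset.sum_const, card_next, nsmul_eq_mul, mul_one]
    congr 2
    rw [← (mem_RW.1 hw).1, List.length_eq_zero_iff]
  rw [Finset.sum_congr rfl h2, Finset.sum_const, Finset.sum_const, nsmul_eq_mul, nsmul_eq_mul,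
    mul_one, mul_comm] at h
  exact_mod_cast h

/-- Sequential estimate of a weighted count of reduced words. -/
lemma sum_RW_le (f : List (Letter k) → ℝ) (q : ℕ → ℝ) (hq : ∀ j, 0 ≤ q j)
    (h : ∀ w, IsReduced w → ∑ b ∈ next w, f (w ++ [b]) ≤ q w.length * (next w).card * f w)
    (n : ℕ) : ∑ w ∈ RW k n, f w ≤ (∏ j ∈ Finset.range n, q j) * (RW k n).card * f [] := by
  induction n with
  | zero => simp [RW]
  | succ n ih =>
    rw [sum_RW_succ, card_RW_succ, Finset.prod_range_succ]
    set d : ℕ := if n = 0 then 2 * k else 2 * k - 1 with hd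
    have h1 : ∀ w ∈ RW k n, ∑ b ∈ next w, f (w ++ [b]) ≤ q n * d * f w := fun w hw => by
      obtain ⟨h1, h2⟩ := mem_RW.1 hw
      refine (h w h2).trans_eq ?_
      rw [h1, card_next, hd, ← h1]
      simp
    refine (Finset.sum_le_sum h1).trans ?_
    rw [← Finset.mul_sum]
    refine (mul_le_mul_of_nonneg_left ih (mul_nonneg (hq n) (Nat.cast_nonneg _))).trans_eq ?_
    push_cast
    ring

open Classical in
/-- Restricting the letters at the positions in `T`. -/
lemma card_restricted_le (hk : 2 ≤ k) (T : Finset ℕ) (R : List (Letter k) → Finset (Letter k))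
    (hR : ∀ t, (R t).card ≤ 2 * k - 2) (n : ℕ) (hT : ∀ j ∈ T, j < n) :
    ((RW k n).filter fun w => ∀ j ∈ T, ∀ c, w[j]? = some c → c ∈ R (w.take j)).card ≤
      ((2 * k - 2) / (2 * k - 1) : ℝ) ^ T.card * (RW k n).card := by
  set θ : ℝ := (2 * k - 2) / (2 * k - 1) with hθ
  have hk' : (2 : ℝ) ≤ k := by exact_mod_cast hk
  have hθ0 : 0 ≤ θ := div_nonneg (by linarith) (by linarith)
  set f : List (Letter k) → ℝ := fun w =>
    if ∀ j ∈ T, ∀ c, w[j]? = some c → c ∈ R (w.take j) then 1 else 0 with hf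
  have h := sum_RW_le f (fun j => if j ∈ T then θ else 1)
    (fun j => by split_ifs <;> positivity) (fun w hw => ?_) n
  · have h1 : f [] = 1 := by simp [hf]
    have h2 : ∏ j ∈ Finset.range n, (if j ∈ T then θ else 1) = θ ^ T.card := by
      rw [Finset.prod_ite_mem, Finset.prod_const]
      congr 2
      exact Finset.inter_eq_right.2 fun j hj => Finset.mem_range.2 (hT j hj)
    rw [h1, h2, mul_one] at h
    refine le_trans (le_of_eq ?_) h
    rw [hf, Finset.sum_boole]
  · have hle : ∀ b, f (w ++ [b]) ≤ f w := fun b => by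
      simp only [hf]
      split_ifs with h1 h2
      · rfl
      · exfalso
        refine h2 fun j hj c hc => ?_
        have hjl : j < w.length := by
          by_contra! hcon
          rw [List.getElem?_eq_none hcon] at hc
          simp at hc
        have h3 := h1 j hj c (by rw [List.getElem?_append_left hjl]; exact hc)
        rwa [List.take_append_of_le_length hjl.le] at h3
      · exact zero_le_one
      · rfl
    by_cases hT' : w.length ∈ T
    · simp only [hT', if_true]
      have hf0 : 0 ≤ f w := by simp only [hf]; split_ifs <;> norm_num
      calc ∑ b ∈ next w, f (w ++ [b]) ≤ ∑ b ∈ next w, if b ∈ R w then f w else 0 := by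
            refine Finset.sum_le_sum fun b _ => ?_
            split_ifs with hb
            · exact hle b
            · simp only [hf]
              rw [if_neg]
              intro hcon
              refine hb ?_
              simpa using hcon w.length hT' b (by simp)
        _ ≤ (2 * k - 2) * f w := by
            rw [← Finset.sum_filter, Finset.sum_const, nsmul_eq_mul]
            refine mul_le_mul_of_nonneg_right ?_ hf0
            have h1 : ((next w).filter fun b => b ∈ R w).card ≤ 2 * k - 2 :=
              (Finset.card_le_card fun b hb => (Finset.mem_filter.1 hb).2).trans (hR w)
            have h2 : (((next w).filter fun b => b ∈ R w).card : ℝ) ≤ ((2 * k - 2 : ℕ) : ℝ) := by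
              exact_mod_cast h1
            rwa [Nat.cast_sub (by omega), Nat.cast_mul] at h2
        _ ≤ θ * (next w).card * f w := by
            refine mul_le_mul_of_nonneg_right ?_ hf0
            have h1 : (2 * k - 1 : ℝ) ≤ (next w).card := by
              have : 2 * k - 1 ≤ (next w).card := by rw [card_next]; split_ifs <;> omega
              have h2 : ((2 * k - 1 : ℕ) : ℝ) ≤ ((next w).card : ℝ) := by exact_mod_cast this
              rwa [Nat.cast_sub (by omega), Nat.cast_mul, Nat.cast_one] at h2
            calc (2 * k - 2 : ℝ) = θ * (2 * k - 1) := by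
                  rw [hθ, div_mul_cancel₀]; linarith
              _ ≤ _ := mul_le_mul_of_nonneg_left h1 hθ0
    · simp only [hT', if_false, one_mul]
      refine (Finset.sum_le_sum fun b _ => hle b).trans_eq ?_
      rw [Finset.sum_const, nsmul_eq_mul]

lemma sum_exp_le {ι : Type*} (F : Finset ι) (X : ι → ℝ) (hX : ∀ i ∈ F, |X i| ≤ 2)
    (h0 : ∑ i ∈ F, X i = 0) {s : ℝ} (hs : |s| ≤ 1 / 2) :
    ∑ i ∈ F, Real.exp (s * X i) ≤ Real.exp (4 * s ^ 2) * F.card := by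
  have h1 : ∀ i ∈ F, Real.exp (s * X i) ≤ 1 + s * X i + 4 * s ^ 2 := fun i hi => by
    have hb : |s * X i| ≤ 1 := by
      rw [abs_mul]
      nlinarith [hX i hi, abs_nonneg s, abs_nonneg (X i)]
    have h2 := (abs_le.1 (Real.abs_exp_sub_one_sub_id_le hb)).2
    have h3 : (s * X i) ^ 2 ≤ 4 * s ^ 2 := by
      have : X i ^ 2 ≤ 2 ^ 2 := sq_le_sq' (abs_le.1 (hX i hi)).1 (abs_le.1 (hX i hi)).2
      nlinarith [sq_nonneg s]
    linarith
  refine (Finset.sum_le_sum h1).trans ?_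
  rw [Finset.sum_add_distrib, Finset.sum_add_distrib, ← Finset.mul_sum, h0]
  simp only [Finset.sum_const, nsmul_eq_mul, mul_one, mul_zero, add_zero]
  nlinarith [Real.add_one_le_exp (4 * s ^ 2), (Nat.cast_nonneg F.card : (0 : ℝ) ≤ F.card)]

/-- The corrector turning the number of occurrences of a two-letter word into a martingale. -/
def corr (a c : Letter k) : ℝ :=
  (if c = a then (2 * k - 1 : ℝ) / (2 * k * (2 * k - 2)) else 0) -
    if c = linv a then (1 : ℝ) / (2 * k * (2 * k - 2)) else 0

lemma corr_bound (hk : 2 ≤ k) (a c : Letter k) : |corr a c| ≤ 3 / 8 := by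
  have hk' : (2 : ℝ) ≤ k := by exact_mod_cast hk
  have h1 : (2 * k - 1 : ℝ) / (2 * k * (2 * k - 2)) ≤ 3 / 8 := by
    rw [div_le_div_iff₀ (by nlinarith) (by norm_num)]
    nlinarith
  have h2 : (1 : ℝ) / (2 * k * (2 * k - 2)) ≤ 3 / 8 := by
    rw [div_le_div_iff₀ (by nlinarith) (by norm_num)]
    nlinarith
  have h3 : (0 : ℝ) ≤ (2 * k - 1) / (2 * k * (2 * k - 2)) :=
    div_nonneg (by linarith) (by nlinarith)
  have h4 : (0 : ℝ) ≤ 1 / (2 * k * (2 * k - 2)) := div_nonneg (by linarith) (by nlinarith)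
  unfold corr
  rw [abs_le]
  split_ifs <;> constructor <;> linarith

/-- The martingale counting occurrences of a two-letter word. -/
def mart (a b : Letter k) (w : List (Letter k)) : ℝ :=
  cnt a b w - w.length / (2 * k * (2 * k - 1)) + (w.getLast?.map (corr a)).getD 0

lemma abs_last_le (hk : 2 ≤ k) (a : Letter k) (w : List (Letter k)) :
    |(w.getLast?.map (corr a)).getD 0| ≤ 3 / 8 := by
  cases w.getLast? with
  | none => norm_num
  | some c => exact corr_bound hk a c

lemma mart_concat (a b : Letter k) (w : List (Letter k)) (x : Letter k) :
    mart a b (w ++ [x]) = mart a b w + ((if w.getLast? = some a ∧ x = b then 1 else 0) -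
      1 / (2 * k * (2 * k - 1)) + corr a x - (w.getLast?.map (corr a)).getD 0) := by
  unfold mart
  rw [cnt_append_singleton]
  simp only [List.length_append, List.length_singleton, List.getLast?_append,
    List.getLast?_singleton, Option.some_or, Option.map_some, Option.getD_some]
  push_cast
  ring

lemma abs_incr_le (hk : 2 ≤ k) (a b : Letter k) (w : List (Letter k)) (x : Letter k) :
    |(if w.getLast? = some a ∧ x = b then (1 : ℝ) else 0) -
      1 / (2 * k * (2 * k - 1)) + corr a x - (w.getLast?.map (corr a)).getD 0| ≤ 2 := by
  have hk' : (2 : ℝ) ≤ k := by exact_mod_cast hk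
  have h1 := abs_le.1 (corr_bound hk a x)
  have h2 := abs_le.1 (abs_last_le hk a w)
  have h3 : (0 : ℝ) ≤ 1 / (2 * k * (2 * k - 1)) := div_nonneg (by linarith) (by nlinarith)
  have h4 : (1 : ℝ) / (2 * k * (2 * k - 1)) ≤ 1 / 12 := by
    rw [div_le_div_iff₀ (by nlinarith) (by norm_num)]
    nlinarith
  rw [abs_le]
  split_ifs <;> constructor <;> linarith

lemma sum_incr (hk : 2 ≤ k) {a b : Letter k} (hab : b ≠ linv a) {w : List (Letter k)}
    (hw : w ≠ []) :
    ∑ x ∈ next w, ((if w.getLast? = some a ∧ x = b then (1 : ℝ) else 0) -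
      1 / (2 * k * (2 * k - 1)) + corr a x - (w.getLast?.map (corr a)).getD 0) = 0 := by
  have hk' : (2 : ℝ) ≤ k := by exact_mod_cast hk
  rcases List.eq_nil_or_concat w with rfl | ⟨v, y, rfl⟩
  · exact absurd rfl hw
  rw [List.concat_eq_append]
  have hn : next (v ++ [y]) = Finset.univ.erase (linv y) := by
    ext b
    simp only [next, List.getLast?_append, List.getLast?_singleton, Option.some_or, ne_eq,
      Option.some.injEq, Finset.mem_filter, Finset.mem_univ, true_and, Finset.mem_erase, and_true]
    rw [← linv_eq_iff, eq_comm]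
  rw [hn, Finset.sum_erase_eq_sub (Finset.mem_univ _)]
  simp only [List.getLast?_append, List.getLast?_singleton, Option.some_or, Option.map_some,
    Option.getD_some, Option.some.injEq]
  have hay : ¬ (y = a ∧ linv y = b) := by
    rintro ⟨rfl, rfl⟩
    exact hab rfl
  rw [if_neg hay]
  have hind : ∑ x : Letter k, (if y = a ∧ x = b then (1 : ℝ) else 0) = if y = a then 1 else 0 := by
    by_cases h : y = a <;> simp [h]
  have hc : ∑ x : Letter k, corr a x = 1 / (2 * k) := by
    simp only [corr, Finset.sum_sub_distrib, Finset.sum_ite_eq', Finset.mem_univ, if_true]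
    have : (k - 1 : ℝ) ≠ 0 := by linarith
    have : (2 * k - 2 : ℝ) = 2 * (k - 1) := by ring
    rw [this]
    field_simp
    ring
  rw [Finset.sum_sub_distrib, Finset.sum_add_distrib, Finset.sum_sub_distrib, hind, hc]
  simp only [Finset.sum_const, Finset.card_univ, card_letter, nsmul_eq_mul]
  have h0 : (2 * k - 2 : ℝ) = 2 * (k - 1) := by ring
  have h1 : (k - 1 : ℝ) ≠ 0 := by linarith
  have h2 : (2 * k - 1 : ℝ) ≠ 0 := by linarith
  have h3 : (k : ℝ) ≠ 0 := by linarith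
  unfold corr
  simp only [linv_eq_iff (a := y), linv_linv, h0]
  by_cases h4 : y = a
  · have h5 : y ≠ linv a := h4 ▸ (linv_ne a).symm
    simp only [h4, if_true, if_neg (h4 ▸ h5)]
    push_cast
    field_simp
    ring
  · by_cases h5 : y = linv a
    · have h6 : linv a ≠ a := linv_ne a
      simp only [h5, if_true, if_neg h6]
      push_cast
      field_simp
      ring
    · simp only [if_neg h4, if_neg h5]
      push_cast
      field_simp
      ring

lemma exp_moment (hk : 2 ≤ k) {a b : Letter k} (hab : b ≠ linv a) {s : ℝ} (hs : |s| ≤ 1 / 2)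
    (n : ℕ) : ∑ w ∈ RW k n, Real.exp (s * mart a b w) ≤
      Real.exp (1 + 4 * s ^ 2 * n) * (RW k n).card := by
  have h := sum_RW_le (k := k) (fun w => Real.exp (s * mart a b w))
    (fun j => Real.exp (if j = 0 then 1 else 4 * s ^ 2)) (fun _ => (Real.exp_pos _).le)
    (fun w hw => ?_) n
  · have h1 : mart a b [] = 0 := by simp [mart, cnt]
    simp only [h1, mul_zero, Real.exp_zero, mul_one] at h
    refine h.trans (mul_le_mul_of_nonneg_right ?_ (Nat.cast_nonneg _))
    rw [← Real.exp_sum, Real.exp_le_exp]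
    calc _ ≤ ∑ j ∈ Finset.range n, ((if j = 0 then 1 else 0) + 4 * s ^ 2) := by
          refine Finset.sum_le_sum fun j _ => ?_
          split_ifs <;> nlinarith [sq_nonneg s]
      _ ≤ _ := by
          rw [Finset.sum_add_distrib, Finset.sum_const, Finset.card_range, nsmul_eq_mul,
            Finset.sum_ite_eq']
          split_ifs <;> linarith
  · simp only [mart_concat, mul_add s, Real.exp_add]
    rw [← Finset.mul_sum, mul_comm (Real.exp (s * mart a b w))]
    refine mul_le_mul_of_nonneg_right ?_ (Real.exp_pos _).le
    simp only [List.length_eq_zero_iff]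
    split_ifs with h0
    · rw [mul_comm (Real.exp 1), ← nsmul_eq_mul]
      refine Finset.sum_le_card_nsmul _ _ _ fun x _ => Real.exp_le_exp.2 ?_
      refine (le_abs_self _).trans ?_
      rw [abs_mul]
      have := abs_incr_le hk a b w x
      nlinarith [abs_nonneg s]
    · exact sum_exp_le _ _ (fun x _ => abs_incr_le hk a b w x) (sum_incr hk hab h0) hs

open Classical in
lemma card_tail_le (hk : 2 ≤ k) {a b : Letter k} (hab : b ≠ linv a) {s : ℝ} (hs : |s| ≤ 1 / 2)
    (l : ℕ) (t : ℝ) :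
    (((RW k l).filter fun w => t ≤ s * (cnt a b w - l / (2 * k * (2 * k - 1)))).card : ℝ) ≤
      Real.exp (2 + 4 * s ^ 2 * l - t) * (RW k l).card := by
  have h := exp_moment hk hab hs l
  have h1 : (((RW k l).filter fun w => t ≤ s * (cnt a b w - l / (2 * k * (2 * k - 1)))).card : ℝ) *
      Real.exp (t - 1) ≤ ∑ w ∈ RW k l, Real.exp (s * mart a b w) := by
    rw [← nsmul_eq_mul]
    refine (Finset.card_nsmul_le_sum _ (fun w => Real.exp (s * mart a b w)) _ fun w hw => ?_).trans
      (Finset.sum_le_sum_of_subset_of_nonneg (Finset.filter_subset _ _)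
        fun _ _ _ => (Real.exp_pos _).le)
    obtain ⟨h1, h2⟩ := Finset.mem_filter.1 hw
    refine Real.exp_le_exp.2 ?_
    unfold mart
    rw [(mem_RW.1 h1).1, mul_add]
    have h3 : |s * (w.getLast?.map (corr a)).getD 0| ≤ 1 := by
      rw [abs_mul]
      nlinarith [abs_last_le hk a w, abs_nonneg s, abs_nonneg ((w.getLast?.map (corr a)).getD 0)]
    linarith [(abs_le.1 h3).1]
  rw [← le_div_iff₀ (Real.exp_pos _)] at h1
  refine h1.trans ((div_le_div_of_nonneg_right h (Real.exp_pos _).le).trans_eq ?_)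
  rw [mul_div_right_comm, ← Real.exp_sub]
  ring_nf

open Classical in
/-- Concentration of the number of occurrences of a two-letter word. -/
lemma card_freq_le (hk : 2 ≤ k) {a b : Letter k} (hab : b ≠ linv a) {η : ℝ} (hη : 0 < η)
    (hη' : η ≤ 1) {l n : ℕ} (hl : l ≤ n) :
    (((RW k l).filter fun w => η * n < |(cnt a b w : ℝ) - l / (2 * k * (2 * k - 1))|).card : ℝ) ≤
      2 * Real.exp (2 - η ^ 2 / 16 * n) * (RW k l).card := by
  have hl' : (l : ℝ) ≤ n := by exact_mod_cast hl
  have hs : |η / 8| ≤ 1 / 2 := by rw [abs_of_pos (by linarith)]; linarith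
  have hs' : |-(η / 8)| ≤ 1 / 2 := by rwa [abs_neg]
  have h1 := card_tail_le hk hab hs l (η ^ 2 / 8 * n)
  have h2 := card_tail_le hk hab hs' l (η ^ 2 / 8 * n)
  have h3 : Real.exp (2 + 4 * (η / 8) ^ 2 * l - η ^ 2 / 8 * n) ≤
      Real.exp (2 - η ^ 2 / 16 * n) := by
    refine Real.exp_le_exp.2 ?_
    nlinarith [sq_nonneg η]
  have hsub : ((RW k l).filter fun w => η * n < |(cnt a b w : ℝ) - l / (2 * k * (2 * k - 1))|) ⊆
      ((RW k l).filter fun w =>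
        η ^ 2 / 8 * n ≤ η / 8 * (cnt a b w - l / (2 * k * (2 * k - 1)))) ∪
      ((RW k l).filter fun w =>
        η ^ 2 / 8 * n ≤ -(η / 8) * (cnt a b w - l / (2 * k * (2 * k - 1)))) := by
    intro w hw
    obtain ⟨hw1, hw2⟩ := Finset.mem_filter.1 hw
    rw [Finset.mem_union, Finset.mem_filter, Finset.mem_filter]
    rcases lt_abs.1 hw2 with h | h
    · exact Or.inl ⟨hw1, by nlinarith⟩
    · exact Or.inr ⟨hw1, by nlinarith⟩
  have h4 : (((RW k l).filter fun w =>
      η * n < |(cnt a b w : ℝ) - l / (2 * k * (2 * k - 1))|).card : ℝ) ≤ _ :=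
    (Nat.cast_le.2 ((Finset.card_le_card hsub).trans (Finset.card_union_le _ _))).trans_eq
      (Nat.cast_add _ _)
  rw [neg_sq] at h2
  have h5 := mul_le_mul_of_nonneg_right h3 (Nat.cast_nonneg (RW k l).card)
  linarith

/-- The ratio bounding the probability of a letter being prescribed. -/
def theta (k : ℕ) : ℝ := (2 * k - 2) / (2 * k - 1)

lemma theta_nonneg (hk : 2 ≤ k) : 0 ≤ theta k := by
  have hk' : (2 : ℝ) ≤ k := by exact_mod_cast hk
  exact div_nonneg (by linarith) (by linarith)

lemma theta_lt_one (hk : 2 ≤ k) : theta k < 1 := by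
  have hk' : (2 : ℝ) ≤ k := by exact_mod_cast hk
  rw [theta, div_lt_one (by linarith)]
  linarith

open Classical in
/-- Prescribing letters from the preceding ones. -/
lemma card_predicted_le (hk : 2 ≤ k) (T : Finset ℕ) (F : List (Letter k) → Option (Letter k))
    (σ : Equiv.Perm (Letter k)) (n : ℕ) (hT : ∀ j ∈ T, j < n) :
    (((RW k n).filter fun w => ∀ j ∈ T, F (w.take j) = w[j]?.map σ).card : ℝ) ≤
      theta k ^ T.card * (RW k n).card := by
  refine le_trans ?_ (card_restricted_le hk T
    (fun t => Finset.univ.filter fun c => F t = some (σ c)) (fun t => ?_) n hT)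
  · refine Nat.cast_le.2 (Finset.card_le_card fun w hw => ?_)
    rw [Finset.mem_filter] at hw ⊢
    refine ⟨hw.1, fun j hj c hc => ?_⟩
    rw [Finset.mem_filter, hw.2 j hj, hc]
    exact ⟨Finset.mem_univ _, rfl⟩
  · refine le_trans (Finset.card_le_one.2 fun c hc d hd => ?_) (by omega : 1 ≤ 2 * k - 2)
    have h := (Finset.mem_filter.1 hc).2.symm.trans (Finset.mem_filter.1 hd).2
    exact σ.injective (Option.some.inj h)

open Classical in
lemma card_earlier_le (hk : 2 ≤ k) (T : Finset ℕ) (e : ℕ → ℕ) (σ : Equiv.Perm (Letter k)) (n : ℕ)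
    (hT : ∀ j ∈ T, j < n) (he : ∀ j ∈ T, e j < j) :
    (((RW k n).filter fun w => ∀ j ∈ T, w[e j]? = w[j]?.map σ).card : ℝ) ≤
      theta k ^ T.card * (RW k n).card := by
  refine le_trans ?_ (card_predicted_le hk T (fun t => t[e t.length]?) σ n hT)
  refine Nat.cast_le.2 (Finset.card_le_card fun w hw => ?_)
  rw [Finset.mem_filter] at hw ⊢
  refine ⟨hw.1, fun j hj => ?_⟩
  have hl : (w.take j).length = j := by
    rw [List.length_take, (mem_RW.1 hw.1).1]
    exact min_eq_left (hT j hj).le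
  simp only [hl]
  rw [List.getElem?_take_of_lt (he j hj), hw.2 j hj]

/-- The subword of length `m` of `v` at position `a'` is the image under `ρ` of the subword of
`w` at position `a`. -/
def Match (ρ : Equiv.Perm (Letter k)) (m a a' : ℕ) (w v : List (Letter k)) : Prop :=
  a + m ≤ w.length ∧ a' + m ≤ v.length ∧ ∀ s < m, v[a' + s]? = w[a + s]?.map ρ

lemma Match.symm {ρ : Equiv.Perm (Letter k)} {m a a' : ℕ} {w v : List (Letter k)}
    (h : Match ρ m a a' w v) : Match ρ⁻¹ m a' a v w := by
  refine ⟨h.2.1, h.1, fun s hs => ?_⟩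
  rw [h.2.2 s hs, Option.map_map]
  simp

lemma match_of_append {ρ : Equiv.Perm (Letter k)} {m : ℕ} {A u B A' B' : List (Letter k)}
    (hm : m ≤ u.length) :
    Match ρ m A.length A'.length (A ++ u ++ B) (A' ++ u.map ρ ++ B') := by
  refine ⟨by simp; omega, by simp; omega, fun s hs => ?_⟩
  have h1 : s < u.length := by omega
  have h2 : ∀ A B u : List (Letter k), s < u.length → (A ++ u ++ B)[A.length + s]? = u[s]? := by
    intro A B u hu
    rw [List.append_assoc, List.getElem?_append_right (by omega), Nat.add_sub_cancel_left,
      List.getElem?_append_left hu]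
  rw [h2 _ _ _ h1, h2 _ _ _ (by simpa using h1)]
  simp

open Classical in
lemma card_match_fixed_le (hk : 2 ≤ k) (ρ : Equiv.Perm (Letter k)) (m a a' n : ℕ)
    (v : List (Letter k)) :
    (((RW k n).filter fun w => Match ρ m a a' w v).card : ℝ) ≤ theta k ^ m * (RW k n).card := by
  by_cases han : a + m ≤ n
  · have h := card_predicted_le hk (Finset.Ico a (a + m)) (fun t => v[a' + (t.length - a)]?) ρ n
      (fun j hj => by rw [Finset.mem_Ico] at hj; omega)
    rw [Nat.card_Ico, Nat.add_sub_cancel_left] at h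
    refine le_trans (Nat.cast_le.2 (Finset.card_le_card fun w hw => ?_)) h
    rw [Finset.mem_filter] at hw ⊢
    refine ⟨hw.1, fun j hj => ?_⟩
    rw [Finset.mem_Ico] at hj
    have hl : (w.take j).length = j := by
      rw [List.length_take, (mem_RW.1 hw.1).1]
      exact min_eq_left (by omega)
    have h2 := hw.2.2.2 (j - a) (by omega)
    rw [Nat.add_sub_cancel' hj.1] at h2
    simp only [hl]
    exact h2
  · rw [Finset.filter_false_of_mem]
    · simpa using mul_nonneg (pow_nonneg (theta_nonneg hk) m) (Nat.cast_nonneg _)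
    · rintro w hw h
      have := (mem_RW.1 hw).1 ▸ h.1
      exact han this

open Classical in
lemma card_match_lt_le (hk : 2 ≤ k) (ρ : Equiv.Perm (Letter k)) {m a a' : ℕ} (n : ℕ)
    (haa : a' < a) :
    (((RW k n).filter fun w => Match ρ m a a' w w).card : ℝ) ≤ theta k ^ m * (RW k n).card := by
  by_cases han : a + m ≤ n
  · have h := card_earlier_le hk (Finset.Ico a (a + m)) (fun j => a' + (j - a)) ρ n
      (fun j hj => by rw [Finset.mem_Ico] at hj; omega)
      (fun j hj => by rw [Finset.mem_Ico] at hj; omega)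
    rw [Nat.card_Ico, Nat.add_sub_cancel_left] at h
    refine le_trans (Nat.cast_le.2 (Finset.card_le_card fun w hw => ?_)) h
    rw [Finset.mem_filter] at hw ⊢
    refine ⟨hw.1, fun j hj => ?_⟩
    rw [Finset.mem_Ico] at hj
    have h2 := hw.2.2.2 (j - a) (by omega)
    rwa [Nat.add_sub_cancel' hj.1] at h2
  · rw [Finset.filter_false_of_mem]
    · simpa using mul_nonneg (pow_nonneg (theta_nonneg hk) m) (Nat.cast_nonneg _)
    · rintro w hw h
      have := (mem_RW.1 hw).1 ▸ h.1
      exact han this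

open Classical in
lemma card_match_eq_le (hk : 2 ≤ k) {ρ : Equiv.Perm (Letter k)} (hρ : ρ ≠ 1) (m a n : ℕ) :
    (((RW k n).filter fun w => Match ρ m a a w w).card : ℝ) ≤ theta k ^ m * (RW k n).card := by
  by_cases han : a + m ≤ n
  · have h := card_restricted_le hk (Finset.Ico a (a + m))
      (fun _ => Finset.univ.filter fun c => ρ c = c) (fun t => ?_) n
      (fun j hj => by rw [Finset.mem_Ico] at hj; omega)
    · rw [Nat.card_Ico, Nat.add_sub_cancel_left] at h
      refine le_trans (Nat.cast_le.2 (Finset.card_le_card fun w hw => ?_)) h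
      rw [Finset.mem_filter] at hw ⊢
      refine ⟨hw.1, fun j hj c hc => ?_⟩
      rw [Finset.mem_Ico] at hj
      have h2 := hw.2.2.2 (j - a) (by omega)
      rw [Nat.add_sub_cancel' hj.1, hc] at h2
      rw [Finset.mem_filter]
      exact ⟨Finset.mem_univ _, (Option.some.inj h2).symm⟩
    · have h1 : (Finset.univ.filter fun c => ρ c = c) = ρ.supportᶜ := by
        ext c
        simp
      rw [h1, Finset.card_compl, card_letter]
      have := Equiv.Perm.two_le_card_support_of_ne_one hρ
      omega
  · rw [Finset.filter_false_of_mem]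
    · simpa using mul_nonneg (pow_nonneg (theta_nonneg hk) m) (Nat.cast_nonneg _)
    · rintro w hw h
      have := (mem_RW.1 hw).1 ▸ h.1
      exact han this

open Classical in
lemma card_match_self_le (hk : 2 ≤ k) {ρ : Equiv.Perm (Letter k)} {m a a' : ℕ} (n : ℕ)
    (h : ¬ (ρ = 1 ∧ a = a')) :
    (((RW k n).filter fun w => Match ρ m a a' w w).card : ℝ) ≤ theta k ^ m * (RW k n).card := by
  rcases lt_trichotomy a' a with haa | rfl | haa
  · exact card_match_lt_le hk ρ n haa
  · exact card_match_eq_le hk (fun h1 => h ⟨h1, rfl⟩) m _ n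
  · refine le_trans (Nat.cast_le.2 (Finset.card_le_card fun w hw => ?_))
      (card_match_lt_le hk ρ⁻¹ n haa)
    rw [Finset.mem_filter] at hw ⊢
    exact ⟨hw.1, hw.2.symm⟩

open Classical in
lemma card_reflect_le (hk : 2 ≤ k) (σ : Equiv.Perm (Letter k)) {m a c : ℕ} (n : ℕ)
    (hac : c ≤ a) (han : a + m ≤ n) :
    (((RW k n).filter fun w => ∀ s < m, w[c + (m - 1 - s)]? = w[a + s]?.map σ).card : ℝ) ≤
      theta k ^ (m / 2) * (RW k n).card := by
  have h := card_earlier_le hk (Finset.Ico (a + m - m / 2) (a + m))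
    (fun j => c + (m - 1 - (j - a))) σ n
    (fun j hj => by rw [Finset.mem_Ico] at hj; omega)
    (fun j hj => by rw [Finset.mem_Ico] at hj; omega)
  rw [Nat.card_Ico, show a + m - (a + m - m / 2) = m / 2 by omega] at h
  refine le_trans (Nat.cast_le.2 (Finset.card_le_card fun w hw => ?_)) h
  rw [Finset.mem_filter] at hw ⊢
  refine ⟨hw.1, fun j hj => ?_⟩
  rw [Finset.mem_Ico] at hj
  have h2 := hw.2 (j - a) (by omega)
  rwa [Nat.add_sub_cancel' (by omega)] at h2

/-- Inversion of letters as a permutation. -/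
def linvPerm (k : ℕ) : Equiv.Perm (Letter k) := ⟨linv, linv, linv_linv, linv_linv⟩

lemma invRev_eq (l : List (Letter k)) : invRev l = (l.map (linvPerm k)).reverse := rfl

lemma getElem?_invRev {l : List (Letter k)} {i : ℕ} (hi : i < l.length) :
    (invRev l)[i]? = l[l.length - 1 - i]?.map (linvPerm k) := by
  rw [invRev_eq, List.getElem?_reverse (by simpa using hi)]
  simp

open Classical in
lemma card_match_inv_le (hk : 2 ≤ k) (ρ : Equiv.Perm (Letter k)) (m a a' n : ℕ) :
    (((RW k n).filter fun w => Match ρ m a a' w (invRev w)).card : ℝ) ≤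
      theta k ^ (m / 2) * (RW k n).card := by
  by_cases han : a + m ≤ n ∧ a' + m ≤ n
  · set c := n - a' - m with hc
    have key : ∀ w ∈ (RW k n).filter fun w => Match ρ m a a' w (invRev w),
        ∀ s < m, w[c + (m - 1 - s)]? = w[a + s]?.map ((linvPerm k)⁻¹ * ρ) := by
      intro w hw s hs
      obtain ⟨h1, h2⟩ := Finset.mem_filter.1 hw
      have hl := (mem_RW.1 h1).1
      have h3 := h2.2.2 s hs
      rw [getElem?_invRev (by omega), hl, show n - 1 - (a' + s) = c + (m - 1 - s) by omega] at h3
      have h4 := congrArg (Option.map ⇑(linvPerm k)⁻¹) h3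
      rw [Option.map_map, Option.map_map] at h4
      simpa [Function.comp_def] using h4
    rcases le_total c a with hac | hac
    · refine le_trans (Nat.cast_le.2 (Finset.card_le_card fun w hw => ?_))
        (card_reflect_le hk ((linvPerm k)⁻¹ * ρ) n hac han.1)
      exact Finset.mem_filter.2 ⟨(Finset.mem_filter.1 hw).1, key w hw⟩
    · refine le_trans (Nat.cast_le.2 (Finset.card_le_card fun w hw => ?_))
        (card_reflect_le hk ((linvPerm k)⁻¹ * ρ)⁻¹ n hac (by omega))
      refine Finset.mem_filter.2 ⟨(Finset.mem_filter.1 hw).1, fun s hs => ?_⟩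
      have h5 := key w hw (m - 1 - s) (by omega)
      rw [show m - 1 - (m - 1 - s) = s by omega] at h5
      rw [h5, Option.map_map, ← Equiv.Perm.coe_mul, inv_mul_cancel, Equiv.Perm.coe_one,
        Option.map_id, id]
  · rw [Finset.filter_false_of_mem]
    · simpa using mul_nonneg (pow_nonneg (theta_nonneg hk) (m / 2)) (Nat.cast_nonneg _)
    · rintro w hw ⟨h1, h2, -⟩
      have := (mem_RW.1 hw).1
      rw [invRev_length] at h2
      omega

/-- Some subword of length `m` of `v` is a relabelling of a subword of `w`. -/
def Coin (m : ℕ) (w v : List (Letter k)) : Prop := ∃ ρ a a', Match ρ m a a' w v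

/-- A nontrivial relabelled repetition within a word. -/
def SelfCoin (m : ℕ) (w : List (Letter k)) : Prop :=
  ∃ ρ a a', Match ρ m a a' w w ∧ ¬ (ρ = 1 ∧ a = a')

/-- The bound for the proportion of words with a coincidence of length `m`. -/
def coinBound (k n m : ℕ) : ℝ := (2 * k).factorial * (n + 1) ^ 2 * theta k ^ (m / 2)

open Classical in
lemma card_exists_le {l n m : ℕ} (P : Equiv.Perm (Letter k) → ℕ → ℕ → List (Letter k) → Prop)
    {Q : List (Letter k) → Prop} (hQ : ∀ w, Q w → ∃ ρ a a', P ρ a a' w)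
    (hP : ∀ ρ a a' w, w ∈ RW k l → P ρ a a' w → a ≤ n ∧ a' ≤ n)
    (h : ∀ ρ a a', (((RW k l).filter fun w => P ρ a a' w).card : ℝ) ≤
      theta k ^ (m / 2) * (RW k l).card) :
    (((RW k l).filter Q).card : ℝ) ≤
      coinBound k n m * (RW k l).card := by
  set S : Finset (Equiv.Perm (Letter k) × ℕ × ℕ) :=
    Finset.univ ×ˢ (Finset.range (n + 1) ×ˢ Finset.range (n + 1)) with hS
  have hsub : ((RW k l).filter Q) ⊆
      S.biUnion fun x => (RW k l).filter fun w => P x.1 x.2.1 x.2.2 w := by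
    intro w hw
    obtain ⟨h1, h0⟩ := Finset.mem_filter.1 hw
    obtain ⟨ρ, a, a', h2⟩ := hQ w h0
    have h3 := hP ρ a a' w h1 h2
    rw [Finset.mem_biUnion]
    refine ⟨(ρ, a, a'), ?_, Finset.mem_filter.2 ⟨h1, h2⟩⟩
    simp only [hS, Finset.mem_product, Finset.mem_univ, Finset.mem_range, true_and]
    omega
  have hcard : S.card = (2 * k).factorial * (n + 1) ^ 2 := by
    rw [hS, Finset.card_product, Finset.card_product, Finset.card_univ, Fintype.card_perm,
      card_letter, Finset.card_range, sq]
  calc (((RW k l).filter Q).card : ℝ)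
      ≤ ∑ x ∈ S, (((RW k l).filter fun w => P x.1 x.2.1 x.2.2 w).card : ℝ) := by
        exact_mod_cast (Finset.card_le_card hsub).trans Finset.card_biUnion_le
    _ ≤ ∑ x ∈ S, theta k ^ (m / 2) * (RW k l).card := Finset.sum_le_sum fun x _ => h _ _ _
    _ = _ := by
        rw [Finset.sum_const, hcard, nsmul_eq_mul, coinBound]
        push_cast
        ring

lemma theta_pow_le (hk : 2 ≤ k) (m : ℕ) : theta k ^ m ≤ theta k ^ (m / 2) :=
  pow_le_pow_of_le_one (theta_nonneg hk) (theta_lt_one hk).le (by omega)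

open Classical in
lemma card_coin_le (hk : 2 ≤ k) {l n m : ℕ} (hl : l ≤ n) {v : List (Letter k)}
    (hv : v.length ≤ n) :
    (((RW k l).filter fun w => Coin m w v).card : ℝ) ≤ coinBound k n m * (RW k l).card := by
  refine card_exists_le (fun ρ a a' w => Match ρ m a a' w v) (fun _ h => h) (fun ρ a a' w hw h => ?_)
    (fun ρ a a' => (card_match_fixed_le hk ρ m a a' l v).trans
      (mul_le_mul_of_nonneg_right (theta_pow_le hk m) (Nat.cast_nonneg _)))
  have := (mem_RW.1 hw).1
  have h1 := h.1
  have h2 := h.2.1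
  omega

open Classical in
lemma card_selfCoin_le (hk : 2 ≤ k) {l n : ℕ} (m : ℕ) (hl : l ≤ n) :
    (((RW k l).filter fun w => SelfCoin m w).card : ℝ) ≤ coinBound k n m * (RW k l).card := by
  refine card_exists_le (fun ρ a a' w => Match ρ m a a' w w ∧ ¬ (ρ = 1 ∧ a = a'))
    (fun _ h => h) (fun ρ a a' w hw h => ?_) (fun ρ a a' => ?_)
  · have := (mem_RW.1 hw).1
    have h1 := h.1.1
    have h2 := h.1.2.1
    omega
  · by_cases h : ρ = 1 ∧ a = a'
    · simpa [h] using mul_nonneg (pow_nonneg (theta_nonneg hk) (m / 2)) (Nat.cast_nonneg _)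
    · simp only [h, not_false_eq_true, and_true]
      exact (card_match_self_le hk l h).trans
        (mul_le_mul_of_nonneg_right (theta_pow_le hk m) (Nat.cast_nonneg _))

open Classical in
lemma card_invCoin_le (hk : 2 ≤ k) {l n : ℕ} (m : ℕ) (hl : l ≤ n) :
    (((RW k l).filter fun w => Coin m w (invRev w)).card : ℝ) ≤
      coinBound k n m * (RW k l).card := by
  refine card_exists_le (fun ρ a a' w => Match ρ m a a' w (invRev w)) (fun _ h => h)
    (fun ρ a a' w hw h => ?_) (fun ρ a a' => card_match_inv_le hk ρ m a a' l)
  have := (mem_RW.1 hw).1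
  have h1 := h.1
  have h2 := h.2.1
  rw [invRev_length] at h2
  omega

/-- Conditions on words, one or two at a time, ensuring genericity. -/
lemma Gen.of_words {w : Fin p → FreeGroup (Fin k)} {n m : ℕ} {δ : ℝ}
    (h1 : ∀ i, n ≤ wlen (w i) + m)
    (h2 : ∀ i a b, b ≠ linv a → |(cnt a b (w i).toWord : ℝ) - tau (w i)| ≤ δ)
    (h3 : ∀ i, ¬ SelfCoin m (w i).toWord)
    (h4 : ∀ i, ¬ Coin m (w i).toWord (invRev (w i).toWord))
    (h5 : ∀ i j, i ≠ j → ∀ e, ¬ Coin m (w i).toWord (gens w (j, e)).toWord) : Gen w n m δ := by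
  have key : ∀ (i : Fin p) (y : Letter p) (ρ : Equiv.Perm (Letter k))
      (A u B A' B' : List (Letter k)), (w i).toWord = A ++ u ++ B →
      (gens w y).toWord = A' ++ u.map ρ ++ B' → m ≤ u.length →
      ρ = 1 ∧ (i, true) = y ∧ A.length = A'.length := by
    rintro i ⟨j, e⟩ ρ A u B A' B' hA hA' hu
    have hM := match_of_append (ρ := ρ) (A := A) (B := B) (A' := A') (B' := B') hu
    rw [← hA, ← hA'] at hM
    by_cases hij : i = j
    · subst hij
      cases e with
      | true =>
        by_contra! hcon
        refine h3 i ⟨ρ, _, _, hM, fun h => hcon h.1 rfl h.2⟩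
      | false =>
        refine absurd ⟨ρ, A.length, A'.length, ?_⟩ (h4 i)
        simpa [gens, toWord_inv] using hM
    · exact absurd ⟨ρ, _, _, hM⟩ (h5 i j hij e)
  refine ⟨h1, h2, ?_⟩
  rintro ⟨i, e⟩ y ρ A u B A' B' hA hA' hu
  cases e with
  | true => exact key i y ρ A u B A' B' hA hA' hu
  | false =>
    have hinv : ∀ z : Letter p, (gens w (linv z)).toWord = invRev (gens w z).toWord := fun z => by
      rw [gens_linv, toWord_inv]
    have hB : (w i).toWord = invRev B ++ invRev u ++ invRev A := by
      have := hinv (i, false)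
      rw [hA] at this
      simpa [gens, linv, invRev_eq] using this
    have hB' : (gens w (linv y)).toWord =
        invRev B' ++ (invRev u).map (linvPerm k * ρ * (linvPerm k)⁻¹) ++ invRev A' := by
      rw [hinv y, hA']
      simp [invRev_eq, Function.comp_def]
    obtain ⟨h6, h7, h8⟩ := key i (linv y) _ _ _ _ _ _ hB hB' (by rwa [invRev_length])
    have h9 : ρ = 1 := by
      rwa [mul_inv_eq_one, mul_eq_left] at h6
    have h10 : (i, false) = y := by
      rw [← linv_linv y, ← h7]
      rfl
    refine ⟨h9, h10, ?_⟩
    subst h10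
    have h11 := congrArg List.length (hA.symm.trans hA')
    simp only [List.length_append, List.length_map] at h11
    rw [invRev_length, invRev_length] at h8
    omega

/-- The ball as a finite set. -/
def ballF (k n : ℕ) : Finset (FreeGroup (Fin k)) :=
  (Finset.range (n + 1)).biUnion fun l => (RW k l).image FreeGroup.mk

lemma coe_ballF (k n : ℕ) : (ballF k n : Set (FreeGroup (Fin k))) = ball k n := by
  ext g
  simp only [ballF, Finset.mem_coe, Finset.mem_biUnion, Finset.mem_range, Finset.mem_image, ball,
    Set.mem_ofPred_eq, wlen]
  constructor
  · rintro ⟨l, hl, w, hw, rfl⟩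
    obtain ⟨h1, h2⟩ := mem_RW.1 hw
    rw [toWord_mk_of_isReduced h2]
    omega
  · intro h
    exact ⟨_, Nat.lt_succ_of_le h, g.toWord, mem_RW.2 ⟨rfl, isReduced_toWord⟩, mk_toWord⟩

lemma card_ballF (k n : ℕ) : (ballF k n).card = ∑ l ∈ Finset.range (n + 1), (RW k l).card := by
  rw [ballF, Finset.card_biUnion]
  · refine Finset.sum_congr rfl fun l _ => Finset.card_image_of_injOn fun v hv w hw h => ?_
    have h1 := toWord_mk_of_isReduced (mem_RW.1 hv).2
    rw [h, toWord_mk_of_isReduced (mem_RW.1 hw).2] at h1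
    exact h1.symm
  · intro l _ l' _ hll
    rw [Function.onFun, Finset.disjoint_left]
    rintro g h1 h2
    obtain ⟨v, hv, rfl⟩ := Finset.mem_image.1 h1
    obtain ⟨w, hw, h⟩ := Finset.mem_image.1 h2
    have h3 := toWord_mk_of_isReduced (mem_RW.1 hv).2
    rw [← h, toWord_mk_of_isReduced (mem_RW.1 hw).2] at h3
    rw [← (mem_RW.1 hv).1, ← (mem_RW.1 hw).1, h3] at hll
    exact hll rfl

lemma card_ballF_pos (k n : ℕ) : 0 < (ballF k n).card := by
  rw [Finset.card_pos]
  refine ⟨1, Finset.mem_coe.1 ?_⟩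
  rw [coe_ballF]
  simp [ball, wlen]

lemma unifBall_apply (k n : ℕ) (E : Set (FreeGroup (Fin k))) [DecidablePred (· ∈ E)] :
    unifBall k n E = ENNReal.ofReal (((ballF k n).filter (· ∈ E)).card / (ballF k n).card) := by
  rw [unifBall, Measure.smul_apply, Measure.restrict_apply MeasurableSet.of_discrete, smul_eq_mul,
    ← coe_ballF, Measure.count_apply_finset]
  have h1 : E ∩ ↑(ballF k n) = ((ballF k n).filter (· ∈ E) : Finset _) := by
    ext g
    simp [and_comm]
  rw [h1, Measure.count_apply_finset,
    ENNReal.ofReal_div_of_pos (by exact_mod_cast card_ballF_pos k n), ENNReal.ofReal_natCast,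
    ENNReal.ofReal_natCast, ENNReal.div_eq_inv_mul]

instance (k n : ℕ) : IsProbabilityMeasure (unifBall k n) := ⟨by
  have h : ((ballF k n).card : ℝ) ≠ 0 := by exact_mod_cast (card_ballF_pos k n).ne'
  rw [unifBall_apply]
  simp [div_self h]⟩

lemma unifBall_compl (k n : ℕ) : unifBall k n {g | n < wlen g} = 0 := by
  classical
  rw [unifBall_apply, Finset.filter_false_of_mem]
  · simp
  · intro g hg h
    rw [← Finset.mem_coe, coe_ballF] at hg
    have h1 : wlen g ≤ n := hg
    exact not_le.2 h h1

open Classical in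
/-- A bound on each sphere gives a bound on the ball. -/
lemma unifBall_le {n : ℕ} {E : Set (FreeGroup (Fin k))} {q : ℝ}
    (h : ∀ l ≤ n, (((RW k l).filter fun w => FreeGroup.mk w ∈ E).card : ℝ) ≤
      q * (RW k l).card) : unifBall k n E ≤ ENNReal.ofReal q := by
  rw [unifBall_apply]
  refine ENNReal.ofReal_le_ofReal ?_
  rw [div_le_iff₀ (by exact_mod_cast card_ballF_pos k n), card_ballF]
  push_cast
  rw [Finset.mul_sum]
  have h1 : ((ballF k n).filter (· ∈ E)).card ≤
      ∑ l ∈ Finset.range (n + 1), ((RW k l).filter fun w => FreeGroup.mk w ∈ E).card := by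
    rw [ballF, Finset.filter_biUnion]
    refine Finset.card_biUnion_le.trans (Finset.sum_le_sum fun l _ => ?_)
    rw [Finset.filter_image]
    exact Finset.card_image_le
  refine (Nat.cast_le.2 h1).trans ?_
  push_cast
  refine Finset.sum_le_sum fun l hl => h l ?_
  rw [Finset.mem_range] at hl
  omega

lemma mul_card_ballF_le (hk : 2 ≤ k) (n : ℕ) :
    (2 * k - 1) * (ballF k n).card ≤ (ballF k (n + 1)).card := by
  rw [card_ballF, card_ballF, Finset.sum_range_succ' _ (n + 1), Finset.mul_sum]
  refine le_trans (Finset.sum_le_sum fun l _ => ?_) (Nat.le_add_right _ _)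
  rw [card_RW_succ]
  refine Nat.mul_le_mul_right _ ?_
  split_ifs <;> omega

lemma card_ballF_le (hk : 2 ≤ k) (n j : ℕ) :
    ((ballF k n).card : ℝ) ≤ theta k ^ j * (ballF k (n + j)).card := by
  have hk' : (2 : ℝ) ≤ k := by exact_mod_cast hk
  induction j with
  | zero => simp
  | succ j ih =>
    have h1 : ((2 * k - 1 : ℕ) : ℝ) * (ballF k (n + j)).card ≤ (ballF k (n + j + 1)).card := by
      exact_mod_cast mul_card_ballF_le hk (n + j)
    rw [Nat.cast_sub (by omega)] at h1
    push_cast at h1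
    have h2 : ((ballF k (n + j)).card : ℝ) ≤ theta k * (ballF k (n + j + 1)).card := by
      rw [theta, div_mul_eq_mul_div, le_div_iff₀ (by linarith)]
      have : (0 : ℝ) ≤ (ballF k (n + j + 1)).card := Nat.cast_nonneg _
      nlinarith
    refine ih.trans ?_
    rw [pow_succ, mul_assoc]
    exact mul_le_mul_of_nonneg_left h2 (pow_nonneg (theta_nonneg hk) j)

lemma factor_pos (k n : ℕ) : (1 : ℝ) ≤ (2 * k).factorial * (n + 1) ^ 2 := by
  have h1 : (1 : ℝ) ≤ (2 * k).factorial := by exact_mod_cast Nat.factorial_pos _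
  have h2 : (1 : ℝ) ≤ ((n : ℝ) + 1) ^ 2 := by
    have : (0 : ℝ) ≤ n := Nat.cast_nonneg n
    nlinarith
  nlinarith

lemma coinBound_nonneg (hk : 2 ≤ k) (n m : ℕ) : 0 ≤ coinBound k n m :=
  mul_nonneg (zero_le_one.trans (factor_pos k n)) (pow_nonneg (theta_nonneg hk) _)

lemma unifBall_short_le (hk : 2 ≤ k) (n m : ℕ) :
    unifBall k n {g | wlen g + m < n} ≤ ENNReal.ofReal (coinBound k n m) := by
  classical
  rw [unifBall_apply]
  refine ENNReal.ofReal_le_ofReal ?_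
  rw [div_le_iff₀ (by exact_mod_cast card_ballF_pos k n)]
  have hfac : theta k ^ m ≤ coinBound k n m := by
    refine (theta_pow_le hk m).trans ?_
    exact le_mul_of_one_le_left (pow_nonneg (theta_nonneg hk) _) (factor_pos k n)
  by_cases hmn : m ≤ n
  · have h1 : (ballF k n).filter (· ∈ {g | wlen g + m < n}) ⊆ ballF k (n - m) := by
      intro g hg
      have h2 := (Finset.mem_filter.1 hg).2
      rw [Set.mem_ofPred_eq] at h2
      rw [← Finset.mem_coe, coe_ballF, ball, Set.mem_ofPred_eq]
      omega
    refine (Nat.cast_le (α := ℝ).2 (Finset.card_le_card h1)).trans ?_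
    have h2 := card_ballF_le hk (n - m) m
    rw [Nat.sub_add_cancel hmn] at h2
    exact h2.trans (mul_le_mul_of_nonneg_right hfac (Nat.cast_nonneg _))
  · rw [Finset.filter_false_of_mem]
    · simpa using mul_nonneg (coinBound_nonneg hk n m) (Nat.cast_nonneg _)
    · intro g _ h
      rw [Set.mem_ofPred_eq] at h
      omega

lemma pi_single (n : ℕ) (i : Fin p) (E : Set (FreeGroup (Fin k))) :
    Measure.pi (fun _ : Fin p => unifBall k n) {w | w i ∈ E} = unifBall k n E :=
  (measurePreserving_eval (fun _ : Fin p => unifBall k n) i).measure_preimage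
    MeasurableSet.of_discrete.nullMeasurableSet

lemma pi_pair {n : ℕ} {i j : Fin p} (hij : i ≠ j)
    (S : Set (FreeGroup (Fin k) × FreeGroup (Fin k))) {q : ENNReal}
    (h : ∀ v, wlen v ≤ n → unifBall k n {u | (u, v) ∈ S} ≤ q) :
    Measure.pi (fun _ : Fin p => unifBall k n) {w | (w i, w j) ∈ S} ≤ q := by
  have hind : ProbabilityTheory.iIndepFun (fun (i : Fin p) (w : Fin p → FreeGroup (Fin k)) => w i)
      (Measure.pi (fun _ : Fin p => unifBall k n)) :=
    ProbabilityTheory.iIndepFun_pi (μ := fun _ : Fin p => unifBall k n)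
      (X := fun _ => id) (fun _ => aemeasurable_id)
  have hm : ∀ i : Fin p, Measurable fun w : Fin p → FreeGroup (Fin k) => w i :=
    fun i => measurable_pi_apply i
  have h1 := (ProbabilityTheory.indepFun_iff_map_prod_eq_prod_map_map (hm i).aemeasurable
    (hm j).aemeasurable).1 (hind.indepFun hij)
  have h2 : ∀ i : Fin p, Measure.map (fun w : Fin p → FreeGroup (Fin k) => w i)
      (Measure.pi (fun _ : Fin p => unifBall k n)) = unifBall k n :=
    fun i => (measurePreserving_eval (fun _ : Fin p => unifBall k n) i).map_eq
  rw [h2, h2] at h1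
  have h3 : Measure.pi (fun _ : Fin p => unifBall k n) {w | (w i, w j) ∈ S} =
      (unifBall k n).prod (unifBall k n) S := by
    rw [← h1, Measure.map_apply ((hm i).prodMk (hm j)) MeasurableSet.of_discrete]
    rfl
  rw [h3, Measure.prod_apply_symm MeasurableSet.of_discrete]
  have hae : ∀ᵐ v ∂(unifBall k n), unifBall k n ((fun u => (u, v)) ⁻¹' S) ≤ q := by
    refine measure_mono_null (fun v hv => ?_) (unifBall_compl k n)
    by_contra hcon
    exact hv (h v (not_lt.1 hcon))
  calc _ ≤ ∫⁻ _, q ∂(unifBall k n) := lintegral_mono_ae hae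
    _ = q := by simp

lemma expDecay_of_le_geometric {f : ℕ → ENNReal} {K r : ℝ} (hK : 0 ≤ K) (hr : 0 < r) (hr' : r < 1)
    (h : ∀ n, f n ≤ ENNReal.ofReal (K * r ^ n)) : ExpDecay f := by
  refine ⟨K + 1, by linarith, r⁻¹, (one_lt_inv₀ hr).2 hr', fun n => (h n).trans ?_⟩
  refine ENNReal.ofReal_le_ofReal ?_
  rw [inv_pow, div_inv_eq_mul]
  nlinarith [pow_pos hr n]

lemma expDecay_of_le_sq_mul_geometric {f : ℕ → ENNReal} {K r : ℝ} (hK : 0 ≤ K) (hr : 0 < r)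
    (hr' : r < 1) (h : ∀ n, f n ≤ ENNReal.ofReal (K * (n + 1) ^ 2 * r ^ n)) : ExpDecay f := by
  set s := √r with hs
  have hs0 : 0 < s := Real.sqrt_pos.2 hr
  have hss : s * s = r := Real.mul_self_sqrt hr.le
  have hs1 : s < 1 := by nlinarith
  have ht := tendsto_pow_const_mul_const_pow_of_abs_lt_one 2
    (show |s| < 1 by rwa [abs_of_pos hs0])
  obtain ⟨B, hB⟩ := ht.bddAbove_range
  have hB' : ∀ n : ℕ, ((n : ℝ) + 1) ^ 2 * s ^ n ≤ B / s := fun n => by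
    have h1 := hB ⟨n + 1, rfl⟩
    dsimp only at h1
    rw [le_div_iff₀ hs0, mul_assoc, ← pow_succ]
    exact_mod_cast h1
  have hB0 : 0 ≤ B / s := le_trans (by positivity) (hB' 0)
  refine expDecay_of_le_geometric (K := K * (B / s)) (mul_nonneg hK hB0) hs0 hs1
    fun n => (h n).trans (ENNReal.ofReal_le_ofReal ?_)
  calc K * (n + 1) ^ 2 * r ^ n = K * ((n + 1) ^ 2 * s ^ n) * s ^ n := by
        rw [← hss, mul_pow]; ring
    _ ≤ K * (B / s) * s ^ n := by
        gcongr
        exact hB' n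

lemma expDecay_add {f g : ℕ → ENNReal} (hf : ExpDecay f) (hg : ExpDecay g) :
    ExpDecay fun n => f n + g n := by
  obtain ⟨C, hC, κ, hκ, h⟩ := hf
  obtain ⟨C', hC', κ', hκ', h'⟩ := hg
  have hmin : 1 < min κ κ' := lt_min hκ hκ'
  have hpos : 0 < min κ κ' := by linarith
  refine ⟨C + C', by linarith, min κ κ', hmin, fun n => (add_le_add (h n) (h' n)).trans ?_⟩
  rw [← ENNReal.ofReal_add (by positivity) (by positivity), add_div]
  refine ENNReal.ofReal_le_ofReal (add_le_add ?_ ?_)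
  · gcongr
    exact min_le_left _ _
  · gcongr
    exact min_le_right _ _

lemma expDecay_of_eventually_le {f g : ℕ → ENNReal} (hg : ExpDecay g) (hf : ∀ n, f n ≤ 1) (n₀ : ℕ)
    (h : ∀ n, n₀ ≤ n → f n ≤ g n) : ExpDecay f := by
  obtain ⟨C, hC, κ, hκ, hgn⟩ := hg
  have hκ0 : 0 < κ := by linarith
  have hp : ∀ n : ℕ, 0 < κ ^ n := fun n => pow_pos hκ0 n
  refine ⟨C + κ ^ n₀, add_pos hC (hp _), κ, hκ, fun n => ?_⟩
  rcases le_or_gt n₀ n with hn | hn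
  · refine (h n hn).trans ((hgn n).trans (ENNReal.ofReal_le_ofReal ?_))
    gcongr
    linarith [hp n₀]
  · refine (hf n).trans ?_
    rw [← ENNReal.ofReal_one]
    refine ENNReal.ofReal_le_ofReal ?_
    rw [le_div_iff₀ (hp n), one_mul]
    linarith [pow_le_pow_right₀ hκ.le hn.le]

lemma measure_iUnion_le_card {Ω ι : Type*} [MeasurableSpace Ω] (μ : Measure Ω) [Fintype ι]
    (E : ι → Set Ω) {q : ℝ} (h : ∀ i, μ (E i) ≤ ENNReal.ofReal q) :
    μ (⋃ i, E i) ≤ ENNReal.ofReal (Fintype.card ι * q) := by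
  refine (measure_iUnion_fintype_le μ E).trans ((Finset.sum_le_sum fun i _ => h i).trans_eq ?_)
  rw [Finset.sum_const, Finset.card_univ, nsmul_eq_mul, ENNReal.ofReal_mul (Nat.cast_nonneg _),
    ENNReal.ofReal_natCast]

lemma unifBall_freq_le (hk : 2 ≤ k) {η : ℝ} (hη : 0 < η) (hη' : η ≤ 1) (n : ℕ) (a b : Letter k) :
    unifBall k n {g | b ≠ linv a ∧ η * n < |(cnt a b g.toWord : ℝ) - tau g|} ≤
      ENNReal.ofReal (2 * Real.exp (2 - η ^ 2 / 16 * n)) := by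
  classical
  by_cases hab : b = linv a
  · simp [hab]
  · refine unifBall_le fun l hl => le_trans ?_ (card_freq_le hk hab hη hη' hl)
    refine Nat.cast_le.2 (Finset.card_le_card fun w hw => ?_)
    simp only [Finset.mem_filter] at hw ⊢
    obtain ⟨h1, -, h2⟩ := hw
    obtain ⟨h3, h4⟩ := mem_RW.1 h1
    rw [tau, wlen, toWord_mk_of_isReduced h4, h3] at h2
    exact ⟨h1, h2⟩

lemma unifBall_le_coinBound {n m : ℕ} {P : List (Letter k) → Prop} [DecidablePred P]
    (h : ∀ l ≤ n, (((RW k l).filter P).card : ℝ) ≤ coinBound k n m * (RW k l).card) :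
    unifBall k n {g | P g.toWord} ≤ ENNReal.ofReal (coinBound k n m) := by
  classical
  refine unifBall_le fun l hl => le_trans ?_ (h l hl)
  refine Nat.cast_le.2 (Finset.card_le_card fun w hw => ?_)
  simp only [Finset.mem_filter] at hw ⊢
  obtain ⟨h1, h2⟩ := hw
  rw [Set.mem_ofPred_eq, toWord_mk_of_isReduced (mem_RW.1 h1).2] at h2
  exact ⟨h1, h2⟩

lemma pi_not_gen_le (hk : 2 ≤ k) (p : ℕ) {η : ℝ} (hη : 0 < η) (hη' : η ≤ 1) (n m : ℕ) :
    Measure.pi (fun _ : Fin p => unifBall k n)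
      {w : Fin p → FreeGroup (Fin k) | ¬ Gen w n m (η * n)} ≤
    ENNReal.ofReal ((3 * p + 2 * p ^ 2) * coinBound k n m) +
      ENNReal.ofReal (p * (2 * k) ^ 2 * (2 * Real.exp (2 - η ^ 2 / 16 * n))) := by
  classical
  set μ := Measure.pi (fun _ : Fin p => unifBall k n)
  set S₁ : Set (FreeGroup (Fin k)) := {g | wlen g + m < n}
  set S₂ : Letter k → Letter k → Set (FreeGroup (Fin k)) := fun a b =>
    {g | b ≠ linv a ∧ η * n < |(cnt a b g.toWord : ℝ) - tau g|}
  set S₃ : Set (FreeGroup (Fin k)) := {g | SelfCoin m g.toWord}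
  set S₄ : Set (FreeGroup (Fin k)) := {g | Coin m g.toWord (invRev g.toWord)}
  set S₅ : Fin p × Fin p × Bool → Set (Fin p → FreeGroup (Fin k)) := fun x =>
    {w | x.1 ≠ x.2.1 ∧ Coin m (w x.1).toWord (gens w (x.2.1, x.2.2)).toWord}
  have hsub : {w : Fin p → FreeGroup (Fin k) | ¬ Gen w n m (η * n)} ⊆
      ((⋃ i : Fin p, {w | w i ∈ S₁}) ∪ (⋃ i : Fin p, {w | w i ∈ S₃}) ∪
        (⋃ i : Fin p, {w | w i ∈ S₄}) ∪ ⋃ x, S₅ x) ∪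
      ⋃ x : Fin p × Letter k × Letter k, {w | w x.1 ∈ S₂ x.2.1 x.2.2} := by
    intro w hw
    by_contra hcon
    simp only [Set.mem_union, Set.mem_iUnion, Set.mem_ofPred_eq, not_or, not_exists] at hcon
    obtain ⟨⟨⟨⟨h1, h3⟩, h4⟩, h5⟩, h2⟩ := hcon
    refine hw (Gen.of_words (fun i => not_lt.1 (h1 i)) (fun i a b hab => ?_) h3 h4
      fun i j hij e h => h5 (i, j, e) ⟨hij, h⟩)
    exact not_lt.1 fun h => h2 (i, a, b) ⟨hab, h⟩
  have hc := coinBound_nonneg hk n m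
  have b1 : μ (⋃ i : Fin p, {w | w i ∈ S₁}) ≤ ENNReal.ofReal (p * coinBound k n m) := by
    have := measure_iUnion_le_card μ (fun i : Fin p => {w | w i ∈ S₁})
      (fun i => (pi_single n i S₁).trans_le (unifBall_short_le hk n m))
    rwa [Fintype.card_fin] at this
  have b3 : μ (⋃ i : Fin p, {w | w i ∈ S₃}) ≤ ENNReal.ofReal (p * coinBound k n m) := by
    have := measure_iUnion_le_card μ (fun i : Fin p => {w | w i ∈ S₃})
      (fun i => (pi_single n i S₃).trans_le
        (unifBall_le_coinBound fun l hl => card_selfCoin_le hk m hl))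
    rwa [Fintype.card_fin] at this
  have b4 : μ (⋃ i : Fin p, {w | w i ∈ S₄}) ≤ ENNReal.ofReal (p * coinBound k n m) := by
    have := measure_iUnion_le_card μ (fun i : Fin p => {w | w i ∈ S₄})
      (fun i => (pi_single n i S₄).trans_le
        (unifBall_le_coinBound (P := fun w => Coin m w (invRev w))
          fun l hl => card_invCoin_le hk m hl))
    rwa [Fintype.card_fin] at this
  have b5 : μ (⋃ x, S₅ x) ≤ ENNReal.ofReal (2 * p ^ 2 * coinBound k n m) := by
    have := measure_iUnion_le_card μ S₅ (q := coinBound k n m) fun x => ?_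
    · refine this.trans_eq ?_
      congr 2
      simp only [Fintype.card_prod, Fintype.card_fin, Fintype.card_bool]
      push_cast
      ring
    · obtain ⟨i, j, e⟩ := x
      by_cases hij : i = j
      · simp [S₅, hij]
      · have h1 := pi_pair (n := n) hij {x : FreeGroup (Fin k) × FreeGroup (Fin k) |
          Coin m x.1.toWord (if e then x.2 else x.2⁻¹).toWord}
          (q := ENNReal.ofReal (coinBound k n m)) fun v hv => ?_
        · refine le_trans (measure_mono fun w hw => ?_) h1
          exact hw.2
        · refine unifBall_le_coinBound
            (P := fun w => Coin m w (if e then v else v⁻¹).toWord) fun l hl =>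
            card_coin_le hk hl ?_
          split_ifs
          · exact hv
          · rw [toWord_inv, invRev_length]
            exact hv
  have b2 : μ (⋃ x : Fin p × Letter k × Letter k, {w | w x.1 ∈ S₂ x.2.1 x.2.2}) ≤
      ENNReal.ofReal (p * (2 * k) ^ 2 * (2 * Real.exp (2 - η ^ 2 / 16 * n))) := by
    have := measure_iUnion_le_card μ
      (fun x : Fin p × Letter k × Letter k => {w | w x.1 ∈ S₂ x.2.1 x.2.2})
      (fun x => (pi_single n x.1 (S₂ x.2.1 x.2.2)).trans_le
        (unifBall_freq_le hk hη hη' n x.2.1 x.2.2))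
    refine this.trans_eq ?_
    congr 2
    rw [Fintype.card_prod, Fintype.card_prod, card_letter, Fintype.card_fin]
    push_cast
    ring
  refine (measure_mono hsub).trans ((measure_union_le _ _).trans (add_le_add ?_ b2))
  calc _ ≤ ENNReal.ofReal (p * coinBound k n m) + ENNReal.ofReal (p * coinBound k n m) +
        ENNReal.ofReal (p * coinBound k n m) + ENNReal.ofReal (2 * p ^ 2 * coinBound k n m) :=
        (measure_union_le _ _).trans (add_le_add ((measure_union_le _ _).trans
          (add_le_add ((measure_union_le _ _).trans (add_le_add b1 b3)) b4)) b5)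
    _ = _ := by
        rw [← ENNReal.ofReal_add (by positivity) (by positivity),
          ← ENNReal.ofReal_add (by positivity) (by positivity),
          ← ENNReal.ofReal_add (by positivity) (by positivity)]
        congr 1
        ring

lemma pow_div_le {q : ℝ} (hq : 0 < q) (hq' : q < 1) {D : ℕ} (hD : 0 < D) (n : ℕ) :
    q ^ (n / D) ≤ q⁻¹ * (q ^ (1 / D : ℝ)) ^ n := by
  have hD' : (0 : ℝ) < D := by exact_mod_cast hD
  rw [← Real.rpow_natCast, ← Real.rpow_natCast, ← Real.rpow_mul hq.le, ← Real.rpow_neg_one,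
    ← Real.rpow_add hq]
  refine Real.rpow_le_rpow_of_exponent_ge hq hq'.le ?_
  have h1 : n < D * (n / D) + D := by
    have := Nat.div_add_mod n D
    have := Nat.mod_lt n hD
    omega
  have h2 : (n : ℝ) ≤ D * ((n / D : ℕ) : ℝ) + D := by exact_mod_cast h1.le
  have h3 : 1 / (D : ℝ) * n ≤ ((n / D : ℕ) : ℝ) + 1 := by
    rw [one_div_mul_eq_div, div_le_iff₀ hD']
    linarith
  linarith

lemma expDecay_not_gen (hk : 2 ≤ k) (p : ℕ) {η : ℝ} (hη : 0 < η) (hη' : η ≤ 1) {d : ℕ}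
    (hd : 0 < d) :
    ExpDecay fun n => Measure.pi (fun _ : Fin p => unifBall k n)
      {w : Fin p → FreeGroup (Fin k) | ¬ Gen w n (n / d) (η * n)} := by
  have hk' : (2 : ℝ) ≤ k := by exact_mod_cast hk
  have hθ : 0 < theta k := div_pos (by linarith) (by linarith)
  have hθ' := theta_lt_one hk
  have hD : 0 < d * 2 := by omega
  have hD' : (0 : ℝ) < ((d * 2 : ℕ) : ℝ) := by exact_mod_cast hD
  have h1 : ExpDecay fun n => ENNReal.ofReal ((3 * p + 2 * p ^ 2) * coinBound k n (n / d)) := by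
    refine expDecay_of_le_sq_mul_geometric
      (K := (3 * p + 2 * p ^ 2) * (2 * k).factorial * (theta k)⁻¹)
      (r := theta k ^ (1 / (d * 2 : ℕ) : ℝ)) (by positivity)
      (Real.rpow_pos_of_pos hθ _) (Real.rpow_lt_one hθ.le hθ' (by positivity))
      fun n => ENNReal.ofReal_le_ofReal ?_
    have h2 := pow_div_le hθ hθ' hD n
    rw [coinBound, Nat.div_div_eq_div_mul]
    calc _ = (3 * p + 2 * p ^ 2) * (2 * k).factorial * (n + 1) ^ 2 * theta k ^ (n / (d * 2)) := by
          ring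
      _ ≤ (3 * p + 2 * p ^ 2) * (2 * k).factorial * (n + 1) ^ 2 *
          ((theta k)⁻¹ * (theta k ^ (1 / (d * 2 : ℕ) : ℝ)) ^ n) := by
          gcongr
      _ = _ := by ring
  have h2 : ExpDecay fun n : ℕ =>
      ENNReal.ofReal (p * (2 * k) ^ 2 * (2 * Real.exp (2 - η ^ 2 / 16 * n))) := by
    refine expDecay_of_le_geometric (K := p * (2 * k) ^ 2 * (2 * Real.exp 2))
      (r := Real.exp (-(η ^ 2 / 16))) (by positivity) (Real.exp_pos _)
      (Real.exp_lt_one_iff.2 (by have := pow_pos hη 2; linarith))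
      fun n => ENNReal.ofReal_le_ofReal (le_of_eq ?_)
    rw [← Real.exp_nat_mul, mul_assoc, mul_assoc _ _ (Real.exp (n * _)), mul_assoc 2,
      ← Real.exp_add]
    ring_nf
  exact expDecay_of_eventually_le (expDecay_add h1 h2) (fun n => prob_le_one) 0
    fun n _ => pi_not_gen_le hk p hη hη' n (n / d)

lemma Gen.autMalnormal_of_le (hk : 2 ≤ k) {w : Fin p → FreeGroup (Fin k)} {n : ℕ}
    (hn : 2048 * k ^ 4 ≤ n)
    (hw : Gen w n (n / (2048 * k ^ 4)) (1 / (512 * (k : ℝ) ^ 4) * n)) :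
    AutMalnormal (Subgroup.closure (Set.range w)) := by
  have hk' : (2 : ℝ) ≤ k := by exact_mod_cast hk
  have hk4 : 16 ≤ k ^ 4 := by
    calc 16 = 2 ^ 4 := by norm_num
      _ ≤ k ^ 4 := Nat.pow_le_pow_left hk 4
  set d := 2048 * k ^ 4 with hd
  set m := n / d with hm
  have hm0 : 0 < m := Nat.div_pos hn (by omega)
  have hmd : d * m ≤ n := Nat.mul_div_le n d
  have h7 : 7 * m ≤ n := (Nat.mul_le_mul_right m (by omega)).trans hmd
  refine hw.autMalnormal hk h7 hm0 (ε := 1 / (16 * k ^ 2)) (by positivity) ?_ ?_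
  · rw [one_div_mul_cancel (by positivity)]
  · have hmd' : 2048 * (k : ℝ) ^ 4 * m ≤ n := by exact_mod_cast hmd
    have hm1 : (1 : ℝ) ≤ m := by exact_mod_cast hm0
    set K : ℝ := (k : ℝ) ^ 2 with hK
    have hK4 : (k : ℝ) ^ 4 = K ^ 2 := by rw [hK]; ring
    have hK1 : 4 ≤ K := by nlinarith
    rw [hK4] at hmd' ⊢
    obtain ⟨x, hx⟩ : ∃ x : ℝ, (n : ℝ) = 2048 * K ^ 2 * x :=
      ⟨n / (2048 * K ^ 2), by field_simp⟩
    have hK0 : 0 < K := by linarith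
    have hmx : (m : ℝ) ≤ x := by
      rw [hx] at hmd'
      exact le_of_mul_le_mul_left hmd' (by positivity)
    have e1 : 1 / (512 * K ^ 2) * (n : ℝ) = 4 * x := by
      rw [hx]
      field_simp
      ring
    have e2 : 1 / (16 * K) * ((n : ℝ) - 3 * m) = 128 * K * x - 3 * m / (16 * K) := by
      rw [hx]
      field_simp
      ring
    have e3 : 3 * (m : ℝ) / (16 * K) ≤ K * x := by
      rw [div_le_iff₀ (by positivity)]
      have : 4 * 4 ≤ K * K := mul_le_mul hK1 hK1 (by norm_num) hK0.le
      nlinarith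
    have e4 : 2 * (k : ℝ) * (2 * k - 1) ≤ 4 * K := by nlinarith
    rw [e1, e2]
    have e5 : (4 * x + 4 * m + 3) * (2 * (k : ℝ) * (2 * k - 1)) ≤ (11 * x) * (4 * K) :=
      mul_le_mul (by linarith) e4 (by nlinarith) (by linarith)
    nlinarith

end RandomSubgroup

/-- For `k ≥ 2`, `p ≥ 1`, if `w_1, …, w_p` are chosen independently and
uniformly at random in the ball of radius `n` of `F_k`, then with probability going to 1
exponentially fast as `n → ∞` the subgroup `H = ⟨w_1, …, w_p⟩` is Aut-malnormal. -/
theorem ball_random_subgroup_AutMalnormal (k p : ℕ) (hk : 2 ≤ k) (hp : 1 ≤ p) :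
    ExpDecay (fun n =>
      Measure.pi (fun _ : Fin p => unifBall k n)
        {w : Fin p → FreeGroup (Fin k) |
          ¬ AutMalnormal (Subgroup.closure (Set.range w))}) := by
  refine RandomSubgroup.expDecay_of_eventually_le
    (RandomSubgroup.expDecay_not_gen hk p (η := 1 / (512 * (k : ℝ) ^ 4)) (d := 2048 * k ^ 4)
      (by positivity) ?_ (by positivity)) (fun _ => prob_le_one) (2048 * k ^ 4)
    fun n hn => measure_mono fun w hw h => hw (h.autMalnormal_of_le hk hn)
  have hk1 : (1 : ℝ) ≤ (k : ℝ) ^ 4 := by exact_mod_cast Nat.one_le_pow 4 k (by omega)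
  rw [div_le_one (by linarith)]
  linarith

end
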